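/- arXiv:1304.5083 — 3 statements merged into one kernel-verified Lean document; each statement's English description precedes it below -/
import Mathlib

section
/- The LS-sequence of points (ξ_N)_{N≥1} is uniformly distributed in [0,1): for every continuous function f : [0,1] → ℝ, the averages (1/N) Σ_{i=1}^N f(ξ_i) converge to ∫_0^1 f(x) dx as N → ∞. -/
/-- The coefficient `b(i)`: `b(i) = i` if `i ≤ L−1` and `b(i) = L + (i−L)γ` if `i ≥ L`. -/
noncomputable def bcoef (L : ℕ) (γ : ℝ) (i : ℕ) : ℝ :=
  if i < L then (i : ℝ) else (L : ℝ) + ((i : ℝ) - (L : ℝ)) * γ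

/-- The LS-radical inverse function `φ_{L,S}(n) = Σ_k b(a_k(n)) γ^{k+1}`, where
`a_0(n), a_1(n), …` are the digits of `n` in base `L + S`. -/
noncomputable def phiLS (L S : ℕ) (γ : ℝ) (n : ℕ) : ℝ :=
  ∑ k ∈ Finset.range (Nat.digits (L + S) n).length,
    bcoef L γ ((Nat.digits (L + S) n).getD k 0) * γ ^ (k + 1)

/-- Membership in `ℕ_{L,S}`: the base-`(L+S)` digit string of `n` has no consecutive pair
`(a_k, a_{k+1})` in `E_{L,S} = {L,…,L+S−1} × {1,…,L+S−1}`. -/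
def memNLS (L S : ℕ) (n : ℕ) : Prop :=
  (Nat.digits (L + S) n).Chain' fun a b => ¬(L ≤ a ∧ 1 ≤ b)

open Finset Filter Topology

section Digits

variable {L S : ℕ}

lemma digits_add_base_mul (hLS : 2 ≤ L + S) {i n : ℕ} (hi : i < L + S) (h : i ≠ 0 ∨ n ≠ 0) :
    Nat.digits (L + S) (i + (L + S) * n) = i :: Nat.digits (L + S) n :=
  Nat.digits_add _ (by omega) _ _ hi h

lemma memNLS_iff_isChain (n : ℕ) :
    memNLS L S n ↔ (Nat.digits (L + S) n).IsChain fun a b => ¬(L ≤ a ∧ 1 ≤ b) :=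
  Iff.rfl

lemma memNLS_zero : memNLS L S 0 := by
  simp [memNLS_iff_isChain]

lemma memNLS_add_of_lt (hLS : 2 ≤ L + S) {i : ℕ} (hi : i < L) (n : ℕ) :
    memNLS L S (i + (L + S) * n) ↔ memNLS L S n := by
  by_cases h : i ≠ 0 ∨ n ≠ 0
  · simp only [memNLS_iff_isChain, digits_add_base_mul hLS (by omega : i < L + S) h,
      List.isChain_cons]
    simp [Nat.not_le.2 hi]
  · obtain ⟨rfl, rfl⟩ : i = 0 ∧ n = 0 := by tauto
    simp

lemma memNLS_add_of_le (hL : 1 ≤ L) (hLS : 2 ≤ L + S) {i j : ℕ} (hLi : L ≤ i) (hi : i < L + S)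
    (hj : j < L + S) (n : ℕ) :
    memNLS L S (i + (L + S) * (j + (L + S) * n)) ↔ j = 0 ∧ memNLS L S n := by
  by_cases h : j ≠ 0 ∨ n ≠ 0
  · rw [memNLS_iff_isChain, digits_add_base_mul hLS hi (by omega), List.isChain_cons]
    have h0 : j = 0 → (List.IsChain (fun a b => ¬(L ≤ a ∧ 1 ≤ b))
        (Nat.digits (L + S) (j + (L + S) * n)) ↔ memNLS L S n) := by
      rintro rfl
      exact memNLS_add_of_lt hLS (by omega) n
    rw [digits_add_base_mul hLS hj h] at h0 ⊢
    simp only [List.head?_cons, Option.mem_some_iff, forall_eq', hLi, true_and,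
      Nat.one_le_iff_ne_zero, not_not] at h0 ⊢
    exact and_congr_right h0
  · obtain ⟨rfl, rfl⟩ : j = 0 ∧ n = 0 := by tauto
    simp only [memNLS_iff_isChain, mul_zero, add_zero]
    rw [Nat.digits_of_lt (L + S) i (by omega) hi]
    simp

lemma phiLS_zero (γ : ℝ) : phiLS L S γ 0 = 0 := by simp [phiLS]

lemma phiLS_add (hL : 1 ≤ L) (hLS : 2 ≤ L + S) (γ : ℝ) {i : ℕ} (hi : i < L + S) (n : ℕ) :
    phiLS L S γ (i + (L + S) * n) = bcoef L γ i * γ + γ * phiLS L S γ n := by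
  by_cases h : i ≠ 0 ∨ n ≠ 0
  · simp only [phiLS, digits_add_base_mul hLS hi h, List.length_cons, sum_range_succ',
      List.getD_cons_zero, List.getD_cons_succ, mul_sum]
    rw [add_comm]
    congr 1
    · ring
    · exact sum_congr rfl fun k _ => by ring
  · obtain ⟨rfl, rfl⟩ : i = 0 ∧ n = 0 := by tauto
    have : 0 < L := hL
    simp [phiLS_zero, bcoef, this]

/-- The exponent `e` such that the digit `i` stands for an interval of length `γ ^ e`. -/
def branchExp (L i : ℕ) : ℕ := if i < L then 1 else 2

lemma bcoef_zero (hL : 1 ≤ L) (γ : ℝ) : bcoef L γ 0 = 0 := by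
  have : 0 < L := hL
  simp [bcoef, this]

lemma bcoef_add (γ : ℝ) : bcoef L γ (L + S) = L + S * γ := by
  simp [bcoef]

lemma bcoef_succ_mul (γ : ℝ) (i : ℕ) :
    bcoef L γ (i + 1) * γ = bcoef L γ i * γ + γ ^ branchExp L i := by
  unfold bcoef branchExp
  rcases lt_trichotomy (i + 1) L with h | h | h
  · rw [if_pos h, if_pos (by omega), if_pos (by omega)]
    push_cast; ring
  · subst h
    rw [if_neg (by omega), if_pos (by omega), if_pos (by omega)]
    push_cast; ring
  · rw [if_neg (by omega), if_neg (by omega), if_neg (by omega)]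
    push_cast; ring

lemma monotone_bcoef_mul {γ : ℝ} (hγ : 0 < γ) : Monotone fun i => bcoef L γ i * γ :=
  monotone_nat_of_le_succ fun i => by
    rw [bcoef_succ_mul]
    have := pow_pos hγ (branchExp L i)
    linarith

lemma bcoef_mul_nonneg (hL : 1 ≤ L) {γ : ℝ} (hγ : 0 < γ) (i : ℕ) : 0 ≤ bcoef L γ i * γ := by
  simpa [bcoef_zero hL] using monotone_bcoef_mul (L := L) hγ (Nat.zero_le i)

lemma bcoef_mul_le_one {γ : ℝ} (hγ : 0 < γ) (hγeq : (L : ℝ) * γ + (S : ℝ) * γ ^ 2 = 1) {i : ℕ}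
    (hi : i ≤ L + S) : bcoef L γ i * γ ≤ 1 := by
  have := monotone_bcoef_mul (L := L) hγ hi
  simp only [bcoef_add] at this
  linarith [show ((L : ℝ) + S * γ) * γ = 1 by rw [← hγeq]; ring]

/-- The affine contraction of `[0,1]` onto the interval of the digit `i`. -/
noncomputable def branch (L : ℕ) (γ : ℝ) (i : ℕ) (x : ℝ) : ℝ :=
  bcoef L γ i * γ + γ ^ branchExp L i * x

lemma branch_mem_Icc (hL : 1 ≤ L) {γ : ℝ} (hγ : 0 < γ)
    (hγeq : (L : ℝ) * γ + (S : ℝ) * γ ^ 2 = 1) {i : ℕ} (hi : i < L + S) {x : ℝ}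
    (hx : x ∈ Set.Icc (0 : ℝ) 1) : branch L γ i x ∈ Set.Icc (0 : ℝ) 1 := by
  have h0 := bcoef_mul_nonneg hL hγ i
  have h1 := bcoef_mul_le_one hγ hγeq (i := i + 1) (by omega)
  rw [bcoef_succ_mul] at h1
  have hp := pow_pos hγ (branchExp L i)
  constructor <;> unfold branch <;> nlinarith [hx.1, hx.2]

lemma phiLS_add_of_lt (hL : 1 ≤ L) (hLS : 2 ≤ L + S) (γ : ℝ) {i : ℕ} (hi : i < L) (n : ℕ) :
    phiLS L S γ (i + (L + S) * n) = branch L γ i (phiLS L S γ n) := by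
  rw [phiLS_add hL hLS γ (by omega), branch, branchExp, if_pos hi, pow_one]

lemma phiLS_add_of_le (hL : 1 ≤ L) (hLS : 2 ≤ L + S) (γ : ℝ) {i : ℕ} (hLi : L ≤ i)
    (hi : i < L + S) (n : ℕ) :
    phiLS L S γ (i + (L + S) * ((L + S) * n)) = branch L γ i (phiLS L S γ n) := by
  have h := phiLS_add hL hLS γ (show 0 < L + S by omega) n
  rw [zero_add, bcoef_zero hL] at h
  rw [phiLS_add hL hLS γ hi, h, branch, branchExp, if_neg (by omega)]
  ring

lemma phiLS_mem_Icc (hL : 1 ≤ L) (hLS : 2 ≤ L + S) {γ : ℝ} (hγ : 0 < γ)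
    (hγeq : (L : ℝ) * γ + (S : ℝ) * γ ^ 2 = 1) (n : ℕ) (hn : memNLS L S n) :
    phiLS L S γ n ∈ Set.Icc (0 : ℝ) 1 := by
  induction n using Nat.strong_induction_on with
  | _ n ih =>
    rcases Nat.eq_zero_or_pos n with rfl | hpos
    · simp [phiLS_zero]
    have hlt : n / (L + S) < n := Nat.div_lt_self hpos (by omega)
    have hi : n % (L + S) < L + S := Nat.mod_lt _ (by omega)
    rw [← Nat.mod_add_div n (L + S)] at hn ⊢
    generalize n % (L + S) = i at *
    generalize n / (L + S) = m at *
    rcases lt_or_ge i L with hiL | hiL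
    · rw [phiLS_add_of_lt hL hLS γ hiL]
      exact branch_mem_Icc hL hγ hγeq hi (ih m hlt ((memNLS_add_of_lt hLS hiL m).1 hn))
    · have hj : m % (L + S) < L + S := Nat.mod_lt _ (by omega)
      have hle : m / (L + S) ≤ m := Nat.div_le_self _ _
      rw [← Nat.mod_add_div m (L + S)] at hn ⊢
      obtain ⟨h0, hm⟩ := (memNLS_add_of_le hL hLS hiL hi hj _).1 hn
      rw [h0, zero_add, phiLS_add_of_le hL hLS γ hiL hi]
      exact branch_mem_Icc hL hγ hγeq hi (ih _ (by omega) hm)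

end Digits

section Sums

lemma sum_range_mul_eq (B Y : ℕ) (g : ℕ → ℝ) :
    ∑ n ∈ range (B * Y), g n = ∑ i ∈ range B, ∑ m ∈ range Y, g (i + B * m) := by
  induction Y with
  | zero => simp
  | succ Y ih =>
    rw [Nat.mul_succ, sum_range_add, ih, ← sum_add_distrib]
    exact sum_congr rfl fun i _ => by rw [sum_range_succ, add_comm i]

open Classical in
/-- The sum of `g (φ n)` over the elements `n < X` of `ℕ_{L,S}`. -/
noncomputable def lsSum (L S : ℕ) (γ : ℝ) (g : ℝ → ℝ) (X : ℕ) : ℝ :=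
  ∑ n ∈ range X, if memNLS L S n then g (phiLS L S γ n) else 0

open Classical in
/-- The number of elements of `ℕ_{L,S}` below `X`. -/
noncomputable def lsCount (L S X : ℕ) : ℕ := Nat.count (memNLS L S) X

/-- The cutoff for the part of `ℕ_{L,S}` below `(L + S) ^ 2 * Z` with lowest digit `i`. -/
def branchLen (L S Z i : ℕ) : ℕ := if i < L then (L + S) * Z else Z

variable {L S : ℕ}

lemma lsSum_const (γ c : ℝ) (X : ℕ) : lsSum L S γ (fun _ => c) X = lsCount L S X * c := by
  rw [lsSum, ← sum_filter, sum_const, nsmul_eq_mul, lsCount, Nat.count_eq_card_filter_range]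

lemma lsSum_sub (γ : ℝ) (g h : ℝ → ℝ) (X : ℕ) :
    lsSum L S γ (fun x => g x - h x) X = lsSum L S γ g X - lsSum L S γ h X := by
  rw [lsSum, lsSum, lsSum, ← sum_sub_distrib]
  exact sum_congr rfl fun n _ => by split_ifs <;> simp

lemma abs_lsSum_le (hL : 1 ≤ L) (hLS : 2 ≤ L + S) {γ : ℝ} (hγ : 0 < γ)
    (hγeq : (L : ℝ) * γ + (S : ℝ) * γ ^ 2 = 1) {g : ℝ → ℝ} {M : ℝ}
    (hg : ∀ x ∈ Set.Icc (0 : ℝ) 1, |g x| ≤ M) (X : ℕ) :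
    |lsSum L S γ g X| ≤ M * lsCount L S X := by
  rw [mul_comm, ← lsSum_const γ M X]
  refine (abs_sum_le_sum_abs _ _).trans (sum_le_sum fun n _ => ?_)
  split_ifs with h
  · exact hg _ (phiLS_mem_Icc hL hLS hγ hγeq n h)
  · simp

lemma abs_lsSum_add_sub_le (hL : 1 ≤ L) (hLS : 2 ≤ L + S) {γ : ℝ} (hγ : 0 < γ)
    (hγeq : (L : ℝ) * γ + (S : ℝ) * γ ^ 2 = 1) {g : ℝ → ℝ} {M : ℝ}
    (hg : ∀ x ∈ Set.Icc (0 : ℝ) 1, |g x| ≤ M) (X i : ℕ) :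
    |lsSum L S γ g (X + i) - lsSum L S γ g X| ≤ i * M := by
  have hM : 0 ≤ M := (abs_nonneg _).trans (hg 0 (by simp))
  rw [lsSum, lsSum, sum_range_add, add_sub_cancel_left]
  refine (abs_sum_le_sum_abs _ _).trans ?_
  rw [← nsmul_eq_mul]
  nth_rw 2 [← card_range i]
  refine sum_le_card_nsmul _ _ _ fun n _ => ?_
  split_ifs with h
  · exact hg _ (phiLS_mem_Icc hL hLS hγ hγeq _ h)
  · simpa using hM

lemma lsSum_base_sq_mul (hL : 1 ≤ L) (hLS : 2 ≤ L + S) (γ : ℝ) (g : ℝ → ℝ) (Z : ℕ) :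
    lsSum L S γ g ((L + S) * ((L + S) * Z)) =
      ∑ i ∈ range (L + S), lsSum L S γ (fun x => g (branch L γ i x)) (branchLen L S Z i) := by
  rw [lsSum, sum_range_mul_eq]
  refine sum_congr rfl fun i hi => ?_
  have hi : i < L + S := mem_range.1 hi
  unfold lsSum branchLen
  split_ifs with hiL
  · exact sum_congr rfl fun m _ => by rw [memNLS_add_of_lt hLS hiL, phiLS_add_of_lt hL hLS γ hiL]
  · have hiL : L ≤ i := not_lt.1 hiL
    rw [sum_range_mul_eq, sum_eq_single_of_mem 0 (mem_range.2 (by omega))]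
    · refine sum_congr rfl fun m _ => ?_
      have h := memNLS_add_of_le hL hLS hiL hi (show 0 < L + S by omega) m
      rw [eq_self, true_and, zero_add] at h
      rw [zero_add, h, phiLS_add_of_le hL hLS γ hiL hi]
    · refine fun j hj hj0 => sum_eq_zero fun m _ => ?_
      rw [if_neg]
      rw [memNLS_add_of_le hL hLS hiL hi (mem_range.1 hj)]
      tauto

lemma lsCount_base_sq_mul (hL : 1 ≤ L) (hLS : 2 ≤ L + S) (Z : ℕ) :
    (lsCount L S ((L + S) * ((L + S) * Z)) : ℝ) =
      ∑ i ∈ range (L + S), (lsCount L S (branchLen L S Z i) : ℝ) := by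
  simpa only [lsSum_const, mul_one] using lsSum_base_sq_mul hL hLS 0 (fun _ => 1) Z

lemma lsCount_recurrence (hL : 1 ≤ L) (hLS : 2 ≤ L + S) (Z : ℕ) :
    (lsCount L S ((L + S) * ((L + S) * Z)) : ℝ) =
      L * lsCount L S ((L + S) * Z) + S * lsCount L S Z := by
  rw [lsCount_base_sq_mul hL hLS, sum_range_add]
  congr 1
  · rw [sum_congr rfl fun i hi => by rw [branchLen, if_pos (mem_range.1 hi)]]
    simp
  · simp [branchLen]

lemma lsCount_mono : Monotone (lsCount L S) := by
  classical
  exact fun _ _ h => Nat.count_monotone _ h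

lemma lsCount_add_le (X i : ℕ) : lsCount L S (X + i) ≤ lsCount L S X + i := by
  classical
  rw [lsCount, Nat.count_add]
  exact Nat.add_le_add_left (Nat.count_le _) _

lemma lsCount_zero : lsCount L S 0 = 0 := by
  simp [lsCount]

lemma lsCount_one : lsCount L S 1 = 1 := by
  simp [lsCount, Nat.count_succ, memNLS_zero]

/-- The growth rate of `lsCount` along powers of the base. -/
lemma le_lsCount_pow (hL : 1 ≤ L) (hLS : 2 ≤ L + S) {γ : ℝ} (hγ0 : 0 < γ) (hγ1 : γ < 1)
    (hγeq : (L : ℝ) * γ + (S : ℝ) * γ ^ 2 = 1) (k : ℕ) :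
    γ * γ⁻¹ ^ k ≤ lsCount L S ((L + S) ^ k) := by
  induction k using Nat.twoStepInduction with
  | zero => simpa [lsCount_one] using hγ1.le
  | one =>
    have : lsCount L S 1 ≤ lsCount L S (L + S) := lsCount_mono (by omega)
    rw [lsCount_one] at this
    rw [pow_one, pow_one, mul_inv_cancel₀ hγ0.ne']
    exact_mod_cast this
  | more k h0 h1 =>
    rw [show (L + S) ^ (k + 2) = (L + S) * ((L + S) * (L + S) ^ k) by ring,
      lsCount_recurrence hL hLS, ← pow_succ']
    calc γ * γ⁻¹ ^ (k + 2)
        = γ * γ⁻¹ ^ (k + 2) * (L * γ + S * γ ^ 2) := by rw [hγeq, mul_one]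
      _ = L * (γ * γ⁻¹ ^ (k + 1)) + S * (γ * γ⁻¹ ^ k) := by
        have h := inv_mul_cancel₀ hγ0.ne'
        generalize γ⁻¹ = r at h
        linear_combination (L * γ * r ^ (k + 1) + S * γ * r ^ k * (r * γ + 1)) * h
      _ ≤ _ := by gcongr

/-- How far `lsCount` is from being scaled by `γ⁻¹` under multiplication by the base. -/
noncomputable def scalingDefect (L S : ℕ) (γ : ℝ) (Z : ℕ) : ℝ :=
  γ * lsCount L S ((L + S) * Z) - lsCount L S Z

lemma scalingDefect_base_mul (hL : 1 ≤ L) (hLS : 2 ≤ L + S) {γ : ℝ}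
    (hγeq : (L : ℝ) * γ + (S : ℝ) * γ ^ 2 = 1) (Z : ℕ) :
    scalingDefect L S γ ((L + S) * Z) = -(S * γ) * scalingDefect L S γ Z := by
  rw [scalingDefect, lsCount_recurrence hL hLS, scalingDefect]
  linear_combination (lsCount L S ((L + S) * Z) : ℝ) * hγeq

lemma abs_scalingDefect_add_sub_le (hLS : 2 ≤ L + S) {γ : ℝ} (hγ0 : 0 < γ) (hγ1 : γ < 1)
    (X : ℕ) {i : ℕ} (hi : i < L + S) :
    |scalingDefect L S γ (X + i) - scalingDefect L S γ X| ≤ ((L : ℝ) + S) ^ 2 := by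
  have h1 : lsCount L S X ≤ lsCount L S (X + i) := lsCount_mono (by omega)
  have h2 : lsCount L S (X + i) ≤ lsCount L S X + i := lsCount_add_le X i
  have h3 : lsCount L S ((L + S) * X) ≤ lsCount L S ((L + S) * (X + i)) :=
    lsCount_mono (by gcongr; omega)
  have h4 : lsCount L S ((L + S) * (X + i)) ≤ lsCount L S ((L + S) * X) + (L + S) * i := by
    rw [mul_add]
    exact lsCount_add_le _ _
  have hi' : (i : ℝ) + 1 ≤ (L : ℝ) + S := by exact_mod_cast hi
  have hB : (2 : ℝ) ≤ (L : ℝ) + S := by exact_mod_cast hLS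
  have hi0 : (0 : ℝ) ≤ i := i.cast_nonneg
  have h1' : (lsCount L S X : ℝ) ≤ lsCount L S (X + i) := by exact_mod_cast h1
  have h2' : (lsCount L S (X + i) : ℝ) ≤ lsCount L S X + i := by exact_mod_cast h2
  have h3' : (lsCount L S ((L + S) * X) : ℝ) ≤ lsCount L S ((L + S) * (X + i)) := by
    exact_mod_cast h3
  have h4' : (lsCount L S ((L + S) * (X + i)) : ℝ) ≤ lsCount L S ((L + S) * X) + (L + S) * i := by
    exact_mod_cast h4
  unfold scalingDefect
  generalize (lsCount L S X : ℝ) = a at *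
  generalize (lsCount L S (X + i) : ℝ) = b at *
  generalize (lsCount L S ((L + S) * X) : ℝ) = c at *
  generalize (lsCount L S ((L + S) * (X + i)) : ℝ) = d at *
  have h5 : 0 ≤ γ * (d - c) := mul_nonneg hγ0.le (by linarith)
  have h6 : γ * (d - c) ≤ d - c := mul_le_of_le_one_left (by linarith) hγ1.le
  have h7 : ((L : ℝ) + S) * i ≤ (L + S) ^ 2 := by nlinarith
  have h8 : (i : ℝ) ≤ ((L : ℝ) + S) ^ 2 := by nlinarith
  rw [abs_le]
  constructor <;> nlinarith

lemma abs_scalingDefect_le (hL : 1 ≤ L) (hLS : 2 ≤ L + S) {γ : ℝ} (hγ0 : 0 < γ) (hγ1 : γ < 1)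
    (hγeq : (L : ℝ) * γ + (S : ℝ) * γ ^ 2 = 1) {s : ℝ} (hs1 : 1 ≤ s) (hs : S * γ < s) (k : ℕ) :
    ∀ Z < (L + S) ^ k,
      |scalingDefect L S γ Z| ≤ ((L : ℝ) + S) ^ 2 / (s - S * γ) * s ^ k := by
  have hd : 0 < s - S * γ := sub_pos.2 hs
  induction k with
  | zero =>
    intro Z hZ
    obtain rfl : Z = 0 := by simpa using hZ
    simp only [scalingDefect, mul_zero, lsCount_zero, Nat.cast_zero, sub_self, abs_zero]
    positivity
  | succ k ih =>
    intro Z hZ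
    have hi : Z % (L + S) < L + S := Nat.mod_lt _ (by omega)
    have hq := ih (Z / (L + S)) (Nat.div_lt_of_lt_mul (by rwa [← pow_succ']))
    have h1 := abs_scalingDefect_add_sub_le hLS hγ0 hγ1 ((L + S) * (Z / (L + S))) hi
    rw [Nat.div_add_mod, scalingDefect_base_mul hL hLS hγeq] at h1
    have h2 := abs_sub_abs_le_abs_sub (scalingDefect L S γ Z)
      (-(S * γ) * scalingDefect L S γ (Z / (L + S)))
    rw [abs_mul, abs_neg, abs_of_nonneg (by positivity : (0 : ℝ) ≤ S * γ)] at h2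
    have h3 := mul_le_mul_of_nonneg_left hq (by positivity : (0 : ℝ) ≤ S * γ)
    set C := ((L : ℝ) + S) ^ 2 / (s - S * γ) with hC
    have hC0 : 0 ≤ C := by positivity
    have h4 : ((L : ℝ) + S) ^ 2 = C * (s - S * γ) := by rw [hC]; field_simp
    have h5 : C * (s - S * γ) ≤ C * (s - S * γ) * s ^ k :=
      le_mul_of_one_le_right (by positivity) (one_le_pow₀ hs1)
    rw [pow_succ]
    nlinarith

end Sums

section Asymptotics

variable {L S : ℕ}

lemma tendsto_lsCount (hL : 1 ≤ L) (hLS : 2 ≤ L + S) {γ : ℝ} (hγ0 : 0 < γ) (hγ1 : γ < 1)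
    (hγeq : (L : ℝ) * γ + (S : ℝ) * γ ^ 2 = 1) : Tendsto (lsCount L S) atTop atTop := by
  refine tendsto_atTop_atTop_of_monotone lsCount_mono fun b => ?_
  obtain ⟨k, hk⟩ := pow_unbounded_of_one_lt (b / γ) ((one_lt_inv₀ hγ0).2 hγ1)
  refine ⟨(L + S) ^ k, ?_⟩
  rw [div_lt_iff₀' hγ0] at hk
  exact_mod_cast hk.le.trans (le_lsCount_pow hL hLS hγ0 hγ1 hγeq k)

lemma eventually_abs_scalingDefect_le (hL : 1 ≤ L) (hLS : 2 ≤ L + S) {γ : ℝ} (hγ0 : 0 < γ)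
    (hγ1 : γ < 1) (hγeq : (L : ℝ) * γ + (S : ℝ) * γ ^ 2 = 1) {η : ℝ} (hη : 0 < η) :
    ∀ᶠ Z in atTop, |scalingDefect L S γ Z| ≤ η * lsCount L S Z := by
  have hL0 : (0 : ℝ) < L := by exact_mod_cast hL
  have hSγ : S * γ < γ⁻¹ := by
    rw [← one_div, lt_div_iff₀ hγ0]
    nlinarith [mul_pos hL0 hγ0]
  obtain ⟨s, hs, hsγ⟩ := exists_between (max_lt ((one_lt_inv₀ hγ0).2 hγ1) hSγ)
  obtain ⟨hs1, hs⟩ := max_lt_iff.1 hs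
  have hsγ : s * γ < 1 := by rwa [← one_div, lt_div_iff₀ hγ0] at hsγ
  have hd : 0 < s - S * γ := sub_pos.2 hs
  set C := ((L : ℝ) + S) ^ 2 / (s - S * γ) with hC
  have hlim : Tendsto (fun k : ℕ => C * s * (s * γ) ^ k) atTop (𝓝 0) := by
    simpa using (tendsto_pow_atTop_nhds_zero_of_lt_one (by positivity) hsγ).const_mul (C * s)
  obtain ⟨K, hK⟩ := eventually_atTop.1 (hlim.eventually (ge_mem_nhds (mul_pos hη hγ0)))
  filter_upwards [eventually_ge_atTop ((L + S) ^ K), eventually_ne_atTop 0] with Z hZ hZ0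
  have hk := hK _ ((Nat.le_log_iff_pow_le (by omega) hZ0).2 hZ)
  have hlow : (lsCount L S ((L + S) ^ Nat.log (L + S) Z) : ℝ) ≤ lsCount L S Z := by
    exact_mod_cast lsCount_mono (Nat.pow_log_le_self (L + S) hZ0)
  have hup := abs_scalingDefect_le hL hLS hγ0 hγ1 hγeq hs1.le hs (Nat.log (L + S) Z + 1) Z
    (Nat.lt_pow_succ_log_self (by omega) Z)
  generalize Nat.log (L + S) Z = k at *
  calc |scalingDefect L S γ Z| ≤ C * s ^ (k + 1) := hup
    _ = C * s * (s * γ) ^ k * γ⁻¹ ^ k := by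
      rw [mul_assoc, ← mul_pow, mul_assoc s, mul_inv_cancel₀ hγ0.ne']
      ring
    _ ≤ η * γ * γ⁻¹ ^ k := by gcongr
    _ = η * (γ * γ⁻¹ ^ k) := mul_assoc _ _ _
    _ ≤ η * lsCount L S Z := by
      gcongr
      exact (le_lsCount_pow hL hLS hγ0 hγ1 hγeq k).trans hlow

lemma tendsto_base_mul (hLS : 2 ≤ L + S) : Tendsto (fun Z => (L + S) * Z) atTop atTop :=
  tendsto_id.const_mul_atTop' (by omega)

lemma tendsto_branchLen (hLS : 2 ≤ L + S) (i : ℕ) :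
    Tendsto (fun Z => branchLen L S Z i) atTop atTop := by
  unfold branchLen
  split_ifs
  · exact tendsto_base_mul hLS
  · exact tendsto_id

/-- The elements of `ℕ_{L,S}` with lowest digit `i` have relative frequency `γ ^ branchExp L i`. -/
lemma eventually_abs_lsCount_branchLen_sub_le (hL : 1 ≤ L) (hLS : 2 ≤ L + S) {γ : ℝ}
    (hγ0 : 0 < γ) (hγ1 : γ < 1) (hγeq : (L : ℝ) * γ + (S : ℝ) * γ ^ 2 = 1) {η : ℝ} (hη : 0 < η) :
    ∀ᶠ Z in atTop, ∀ i, |(lsCount L S (branchLen L S Z i) : ℝ) -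
      γ ^ branchExp L i * lsCount L S ((L + S) * ((L + S) * Z))| ≤
        η * lsCount L S ((L + S) * ((L + S) * Z)) := by
  have h := eventually_abs_scalingDefect_le hL hLS hγ0 hγ1 hγeq (half_pos hη)
  filter_upwards [h, (tendsto_base_mul hLS).eventually h] with Z h1 h2 i
  have hle : ∀ n : ℕ, n ≤ (L + S) * n := fun n => Nat.le_mul_of_pos_left n (by omega)
  have m1 : (lsCount L S Z : ℝ) ≤ lsCount L S ((L + S) * Z) := by
    exact_mod_cast lsCount_mono (hle Z)
  have m2 : (lsCount L S ((L + S) * Z) : ℝ) ≤ lsCount L S ((L + S) * ((L + S) * Z)) := by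
    exact_mod_cast lsCount_mono (hle _)
  have m0 : (0 : ℝ) ≤ lsCount L S Z := Nat.cast_nonneg _
  unfold branchLen branchExp
  unfold scalingDefect at h1 h2
  split_ifs
  all_goals
    generalize (lsCount L S ((L + S) * ((L + S) * Z)) : ℝ) = c at *
    generalize (lsCount L S ((L + S) * Z) : ℝ) = b at *
    have e1 : η / 2 * b ≤ η / 2 * c := by gcongr
  · rw [abs_sub_comm, pow_one]
    nlinarith
  · have e0 : η / 2 * (lsCount L S Z : ℝ) ≤ η / 2 * b := by gcongr
    calc |(lsCount L S Z : ℝ) - γ ^ 2 * c|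
        = |(γ * b - lsCount L S Z) + γ * (γ * c - b)| := by
          rw [abs_sub_comm]; ring_nf
      _ ≤ |γ * b - lsCount L S Z| + |γ * (γ * c - b)| := abs_add_le _ _
      _ ≤ |γ * b - lsCount L S Z| + |γ * c - b| := by
          rw [abs_mul, abs_of_pos hγ0]
          gcongr
          exact mul_le_of_le_one_left (abs_nonneg _) hγ1.le
      _ ≤ η * c := by linarith

lemma integral_eq_sum_branch (hL : 1 ≤ L) {γ : ℝ} (hγ0 : 0 < γ)
    (hγeq : (L : ℝ) * γ + (S : ℝ) * γ ^ 2 = 1) {f : ℝ → ℝ}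
    (hf : ContinuousOn f (Set.Icc 0 1)) :
    ∫ x in (0 : ℝ)..1, f x =
      ∑ i ∈ range (L + S), γ ^ branchExp L i * ∫ x in (0 : ℝ)..1, f (branch L γ i x) := by
  have h := intervalIntegral.sum_integral_adjacent_intervals (f := f) (μ := MeasureTheory.volume)
    (a := fun i => bcoef L γ i * γ) (n := L + S) fun k hk => by
      have hle : bcoef L γ k * γ ≤ bcoef L γ (k + 1) * γ := monotone_bcoef_mul hγ0 (Nat.le_succ k)
      refine ContinuousOn.intervalIntegrable ?_
      rw [Set.uIcc_of_le hle]
      exact hf.mono (Set.Icc_subset_Icc (bcoef_mul_nonneg hL hγ0 k)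
        (bcoef_mul_le_one hγ0 hγeq (by omega)))
  rw [bcoef_zero hL, zero_mul, bcoef_add, show ((L : ℝ) + S * γ) * γ = 1 by rw [← hγeq]; ring] at h
  rw [← h]
  refine sum_congr rfl fun i _ => ?_
  rw [bcoef_succ_mul, ← smul_eq_mul (γ ^ branchExp L i)]
  unfold branch
  rw [intervalIntegral.smul_integral_comp_add_mul, mul_zero, mul_one, add_zero]

/-- The sum over `ℕ_{L,S}` below `X` minus its expected value. -/
noncomputable def lsErr (L S : ℕ) (γ : ℝ) (f : ℝ → ℝ) (X : ℕ) : ℝ :=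
  lsSum L S γ f X - lsCount L S X * ∫ x in (0 : ℝ)..1, f x

lemma lsErr_eq_lsSum (γ : ℝ) (f : ℝ → ℝ) (X : ℕ) :
    lsErr L S γ f X = lsSum L S γ (fun x => f x - ∫ y in (0 : ℝ)..1, f y) X := by
  rw [lsSum_sub, lsSum_const, lsErr]

lemma lsErr_base_sq_mul (hL : 1 ≤ L) (hLS : 2 ≤ L + S) {γ : ℝ} (hγ0 : 0 < γ)
    (hγeq : (L : ℝ) * γ + (S : ℝ) * γ ^ 2 = 1) {f : ℝ → ℝ}
    (hf : ContinuousOn f (Set.Icc 0 1)) (Z : ℕ) :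
    lsErr L S γ f ((L + S) * ((L + S) * Z)) =
      ∑ i ∈ range (L + S), (lsErr L S γ (fun x => f (branch L γ i x)) (branchLen L S Z i) +
        (lsCount L S (branchLen L S Z i) -
          γ ^ branchExp L i * lsCount L S ((L + S) * ((L + S) * Z))) *
            ∫ x in (0 : ℝ)..1, f (branch L γ i x)) := by
  rw [lsErr, lsSum_base_sq_mul hL hLS, integral_eq_sum_branch hL hγ0 hγeq hf, mul_sum,
    ← sum_sub_distrib]
  refine sum_congr rfl fun i _ => ?_
  rw [lsErr]
  ring

lemma abs_integral_le_of_bound {f : ℝ → ℝ} {M : ℝ} (hM : ∀ x ∈ Set.Icc (0 : ℝ) 1, |f x| ≤ M) :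
    |∫ x in (0 : ℝ)..1, f x| ≤ M := by
  have := intervalIntegral.norm_integral_le_of_norm_le_const (f := f) (C := M) (a := 0) (b := 1)
    fun x hx => hM x (by rw [Set.uIoc_of_le zero_le_one] at hx; exact ⟨hx.1.le, hx.2⟩)
  simpa using this

lemma eventually_abs_lsErr_le_of_branch (hL : 1 ≤ L) (hLS : 2 ≤ L + S) {γ : ℝ}
    (hγ0 : 0 < γ) (hγ1 : γ < 1) (hγeq : (L : ℝ) * γ + (S : ℝ) * γ ^ 2 = 1) {f : ℝ → ℝ}
    (hf : ContinuousOn f (Set.Icc 0 1)) {ε : ℝ} (hε : 0 ≤ ε)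
    (hbr : ∀ i < L + S, ∀ ε' > ε, ∀ᶠ X in atTop,
      |lsErr L S γ (fun x => f (branch L γ i x)) X| ≤ ε' * lsCount L S X) :
    ∀ ε' > ε, ∀ᶠ X in atTop, |lsErr L S γ f X| ≤ ε' * lsCount L S X := by
  intro ε' hε'
  obtain ⟨M, hM⟩ := isCompact_Icc.exists_bound_of_continuousOn hf
  simp only [Real.norm_eq_abs] at hM
  have hM0 : 0 ≤ M := (abs_nonneg _).trans (hM 0 (by simp))
  have hfM : ∀ x ∈ Set.Icc (0 : ℝ) 1, |f x - ∫ y in (0 : ℝ)..1, f y| ≤ 2 * M := fun x hx => by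
    have := abs_sub (f x) (∫ y in (0 : ℝ)..1, f y)
    linarith [hM x hx, abs_integral_le_of_bound hM]
  obtain ⟨δ, hδ, rfl⟩ : ∃ δ > 0, ε' = ε + 3 * δ := ⟨(ε' - ε) / 3, by linarith, by ring⟩
  have hB : (0 : ℝ) < ((L + S : ℕ) : ℝ) := by exact_mod_cast (show 0 < L + S by omega)
  have hη : 0 < δ / ((L + S : ℕ) * (M + 1)) := by positivity
  have hZ : ∀ᶠ Z in atTop, |lsErr L S γ f ((L + S) * ((L + S) * Z))| ≤
      (ε + 2 * δ) * lsCount L S ((L + S) * ((L + S) * Z)) := by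
    have hE := (eventually_all_finset (range (L + S))).2 fun i hi =>
      (tendsto_branchLen hLS i).eventually (hbr i (mem_range.1 hi) (ε + δ) (by linarith))
    filter_upwards [hE, eventually_abs_lsCount_branchLen_sub_le hL hLS hγ0 hγ1 hγeq hη]
      with Z h1 h2
    rw [lsErr_base_sq_mul hL hLS hγ0 hγeq hf]
    set N : ℝ := (lsCount L S ((L + S) * ((L + S) * Z)) : ℝ) with hN
    have hN0 : 0 ≤ N := Nat.cast_nonneg _
    calc _ ≤ ∑ i ∈ range (L + S), ((ε + δ) * lsCount L S (branchLen L S Z i) +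
          δ / ((L + S : ℕ) * (M + 1)) * N * M) := by
          refine (abs_sum_le_sum_abs _ _).trans (sum_le_sum fun i hi => ?_)
          refine (abs_add_le _ _).trans (add_le_add (h1 i hi) ?_)
          rw [abs_mul]
          gcongr
          · exact h2 i
          · exact abs_integral_le_of_bound fun x hx =>
              hM _ (branch_mem_Icc hL hγ0 hγeq (mem_range.1 hi) hx)
      _ = (ε + δ) * N + δ * N * (M / (M + 1)) := by
          rw [sum_add_distrib, ← mul_sum, ← lsCount_base_sq_mul hL hLS, ← hN, sum_const,
            card_range, nsmul_eq_mul]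
          field_simp
      _ ≤ (ε + δ) * N + δ * N * 1 := by
          gcongr
          exact (div_le_one (by linarith)).2 (by linarith)
      _ = (ε + 2 * δ) * N := by ring
  have hdiv : Tendsto (fun X => X / ((L + S) * (L + S))) atTop atTop :=
    Nat.tendsto_div_const_atTop (by positivity)
  have hlarge := ((tendsto_natCast_atTop_atTop (R := ℝ)).comp
    (tendsto_lsCount hL hLS hγ0 hγ1 hγeq)).eventually
      (eventually_ge_atTop (((L + S) * (L + S) : ℕ) * (2 * M) / δ))
  filter_upwards [hdiv.eventually hZ, hlarge] with X h1 h2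
  rw [Function.comp_apply, div_le_iff₀' hδ] at h2
  have hr := Nat.mod_lt X (show 0 < (L + S) * (L + S) by positivity)
  have hX := Nat.div_add_mod X ((L + S) * (L + S))
  rw [mul_assoc] at hX
  generalize X / ((L + S) * (L + S)) = Z at *
  generalize X % ((L + S) * (L + S)) = r at *
  subst hX
  have h3 := abs_lsSum_add_sub_le hL hLS hγ0 hγeq hfM ((L + S) * ((L + S) * Z)) r
  rw [← lsErr_eq_lsSum, ← lsErr_eq_lsSum] at h3
  have h4 := abs_sub_abs_le_abs_sub (lsErr L S γ f ((L + S) * ((L + S) * Z) + r))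
    (lsErr L S γ f ((L + S) * ((L + S) * Z)))
  have h5 : (r : ℝ) * (2 * M) ≤ ((L + S) * (L + S) : ℕ) * (2 * M) := by gcongr
  have h6 : (ε + 2 * δ) * (lsCount L S ((L + S) * ((L + S) * Z)) : ℝ) ≤
      (ε + 2 * δ) * lsCount L S ((L + S) * ((L + S) * Z) + r) := by
    gcongr
    exact lsCount_mono (Nat.le_add_right _ _)
  linarith

lemma abs_branch_sub {γ : ℝ} (hγ0 : 0 < γ) (hγ1 : γ < 1) (i : ℕ) (x y : ℝ) :
    |branch L γ i x - branch L γ i y| ≤ γ * |x - y| := by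
  rw [branch, branch, add_sub_add_left_eq_sub, ← mul_sub, abs_mul, abs_of_pos (by positivity)]
  gcongr
  refine pow_le_of_le_one hγ0.le hγ1.le ?_
  unfold branchExp
  split_ifs <;> simp

lemma continuous_branch (γ : ℝ) (i : ℕ) : Continuous (branch L γ i) := by
  unfold branch
  fun_prop

lemma eventually_abs_lsErr_le_of_modulus (hL : 1 ≤ L) (hLS : 2 ≤ L + S) {γ : ℝ}
    (hγ0 : 0 < γ) (hγ1 : γ < 1) (hγeq : (L : ℝ) * γ + (S : ℝ) * γ ^ 2 = 1) {ε : ℝ} (hε : 0 ≤ ε)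
    (k : ℕ) (f : ℝ → ℝ) (hf : ContinuousOn f (Set.Icc 0 1))
    (hmod : ∀ x ∈ Set.Icc (0 : ℝ) 1, ∀ y ∈ Set.Icc (0 : ℝ) 1, |x - y| ≤ γ ^ k → |f x - f y| ≤ ε) :
    ∀ ε' > ε, ∀ᶠ X in atTop, |lsErr L S γ f X| ≤ ε' * lsCount L S X := by
  induction k generalizing f with
  | zero =>
    intro ε' hε'
    refine Eventually.of_forall fun X => ?_
    have hfint : IntervalIntegrable f MeasureTheory.volume 0 1 :=
      ContinuousOn.intervalIntegrable (by rwa [Set.uIcc_of_le zero_le_one])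
    have h : ∀ x ∈ Set.Icc (0 : ℝ) 1, |f x - ∫ y in (0 : ℝ)..1, f y| ≤ ε := fun x hx => by
      have := abs_integral_le_of_bound (f := fun y => f x - f y) (M := ε) fun y hy =>
        hmod x hx y hy (by
          rw [pow_zero, abs_le]
          constructor <;> linarith [hx.1, hx.2, hy.1, hy.2])
      rw [intervalIntegral.integral_sub (by simp) hfint] at this
      simpa using this
    rw [lsErr_eq_lsSum]
    refine (abs_lsSum_le hL hLS hγ0 hγeq h X).trans ?_
    gcongr
  | succ k ih =>
    refine eventually_abs_lsErr_le_of_branch hL hLS hγ0 hγ1 hγeq hf hε fun i hi => ih _ ?_ ?_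
    · exact hf.comp (continuous_branch γ i).continuousOn
        fun x hx => branch_mem_Icc hL hγ0 hγeq hi hx
    · intro x hx y hy hxy
      refine hmod _ (branch_mem_Icc hL hγ0 hγeq hi hx) _ (branch_mem_Icc hL hγ0 hγeq hi hy)
        ((abs_branch_sub hγ0 hγ1 i x y).trans ?_)
      rw [pow_succ']
      gcongr

lemma eventually_abs_lsErr_le (hL : 1 ≤ L) (hLS : 2 ≤ L + S) {γ : ℝ}
    (hγ0 : 0 < γ) (hγ1 : γ < 1) (hγeq : (L : ℝ) * γ + (S : ℝ) * γ ^ 2 = 1) {f : ℝ → ℝ}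
    (hf : ContinuousOn f (Set.Icc 0 1)) {ε : ℝ} (hε : 0 < ε) :
    ∀ᶠ X in atTop, |lsErr L S γ f X| ≤ ε * lsCount L S X := by
  obtain ⟨δ, hδ, h⟩ := Metric.uniformContinuousOn_iff_le.1
    (isCompact_Icc.uniformContinuousOn_of_continuous hf) (ε / 2) (half_pos hε)
  obtain ⟨k, hk⟩ := exists_pow_lt_of_lt_one hδ hγ1
  exact eventually_abs_lsErr_le_of_modulus hL hLS hγ0 hγ1 hγeq (half_pos hε).le k f hf
    (fun x hx y hy hxy => h x hx y hy (hxy.trans hk.le)) ε (half_lt_self hε)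

lemma infinite_memNLS (hL : 1 ≤ L) (hLS : 2 ≤ L + S) {γ : ℝ} (hγ0 : 0 < γ) (hγ1 : γ < 1)
    (hγeq : (L : ℝ) * γ + (S : ℝ) * γ ^ 2 = 1) : (Set.ofPred (memNLS L S)).Infinite := by
  classical
  intro hfin
  obtain ⟨X, hX⟩ := ((tendsto_lsCount hL hLS hγ0 hγ1 hγeq).eventually
    (eventually_gt_atTop (#hfin.toFinset))).exists
  exact absurd (Nat.count_le_card hfin X) (by rw [lsCount] at hX; convert hX.not_ge)

lemma lsCount_nth (hinf : (Set.ofPred (memNLS L S)).Infinite) (N : ℕ) :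
    lsCount L S (Nat.nth (memNLS L S) N) = N := by
  classical
  exact Nat.count_nth_of_infinite hinf N

lemma lsSum_nth (hinf : (Set.ofPred (memNLS L S)).Infinite) (γ : ℝ) (f : ℝ → ℝ) (N : ℕ) :
    lsSum L S γ f (Nat.nth (memNLS L S) N) =
      ∑ j ∈ range N, f (phiLS L S γ (Nat.nth (memNLS L S) j)) := by
  classical
  induction N with
  | zero =>
    have h := Nat.count_nth_zero (memNLS L S)
    rw [Nat.count_eq_card_filter_range, card_eq_zero] at h
    rw [lsSum, ← sum_filter, h, sum_empty, range_zero, sum_empty]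
  | succ N ih =>
    rw [lsSum, ← sum_filter, Nat.filter_range_nth_eq_insert_of_infinite hinf,
      sum_insert (by simp), sum_range_succ, ← ih, lsSum, ← sum_filter, add_comm]

end Asymptotics

/-- The LS-sequence of points `ξ_N = φ_{L,S}(m_N)` (with `m_1 < m_2 < ⋯`
the increasing enumeration of `ℕ_{L,S}`) is uniformly distributed in `[0,1)`: for every
continuous `f : [0,1] → ℝ`, `(1/N) Σ_{i=1}^N f(ξ_i) → ∫₀¹ f(x) dx` as `N → ∞`. -/
theorem stmt_16 (L S : ℕ) (hL : 1 ≤ L) (hLS : 2 ≤ L + S)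
    (γ : ℝ) (hγ0 : 0 < γ) (hγ1 : γ < 1)
    (hγeq : (L : ℝ) * γ + (S : ℝ) * γ ^ 2 = 1) :
    ∀ f : ℝ → ℝ, ContinuousOn f (Set.Icc 0 1) →
      Filter.Tendsto
        (fun N : ℕ => (1 / (N : ℝ)) *
          ∑ j ∈ Finset.range N, f (phiLS L S γ (Nat.nth (memNLS L S) j)))
        Filter.atTop (nhds (∫ x in (0:ℝ)..1, f x)) := by
  intro f hf
  have hinf := infinite_memNLS hL hLS hγ0 hγ1 hγeq
  rw [Metric.tendsto_nhds]
  intro ε hε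
  have h := (Nat.nth_strictMono hinf).tendsto_atTop.eventually
    (eventually_abs_lsErr_le hL hLS hγ0 hγ1 hγeq hf (half_pos hε))
  filter_upwards [h, eventually_gt_atTop 0] with N hN hN0
  have hN0 : (0 : ℝ) < N := by exact_mod_cast hN0
  rw [lsErr, lsSum_nth hinf, lsCount_nth hinf] at hN
  rw [Real.dist_eq]
  refine lt_of_le_of_lt ?_ (half_lt_self hε)
  refine le_of_mul_le_mul_left ?_ hN0
  rw [← abs_of_pos hN0, ← abs_mul, abs_of_pos hN0, mul_sub, one_div, mul_inv_cancel_left₀ hN0.ne',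
    mul_comm _ (ε / 2)]
  exact hN
end

section
/- Kakutani's theorem: let α ∈ (0,1) and let P_n be the n-th successive α-refinement of the trivial partition {0} of [0,1). Then the sequence of partitions (P_n) is uniformly distributed: for every continuous function f : [0,1] → ℝ, (1/|P_n|) Σ_{y ∈ P_n} f(y) → ∫_0^1 f(x) dx as n → ∞. -/
/-- For a partition of `[0,1)` represented by a finite set `P ⊂ [0,1)` with `0 ∈ P`,
`nextPt P y` is the right endpoint of the interval of `P` with left endpoint `y`:
the least element of `P` greater than `y`, or `1` if there is none. -/
noncomputable def nextPt (P : Finset ℝ) (y : ℝ) : ℝ :=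
  sInf ({z : ℝ | z ∈ P ∧ y < z} ∪ {1})

/-- The maximal length of an interval of the partition `P`. -/
noncomputable def maxLen (P : Finset ℝ) : ℝ :=
  sSup ((fun y => nextPt P y - y) '' (P : Set ℝ))

/-- Kakutani's `α`-refinement: each interval `[y, nextPt P y)` of `P` of maximal length is
split in proportion `α` and `1 − α` by adding the point `y + α·(nextPt P y − y)`. -/
noncomputable def alphaRefine (α : ℝ) (P : Finset ℝ) : Finset ℝ :=
  P ∪ (P.filter fun y => nextPt P y - y = maxLen P).image
    fun y => y + α * (nextPt P y - y)

/-- The tiles `(left endpoint, length)`, listed from left to right, of the partition of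
`[u, u + ℓ)` obtained by splitting in proportion `α` and `1 - α` as long as the length of a
piece exceeds `x`. -/
noncomputable def leaves (α x u ℓ : ℝ) : List (ℝ × ℝ) :=
  if _h : 0 < α ∧ α < 1 ∧ 0 < x ∧ x < ℓ then
    leaves α x u (α * ℓ) ++ leaves α x (u + α * ℓ) ((1 - α) * ℓ)
  else [(u, ℓ)]
termination_by ⌈Real.log (ℓ / x) / -Real.log (max α (1 - α))⌉₊
decreasing_by
  all_goals
    obtain ⟨h0, h1, hx, hl⟩ := _h
    have key : ∀ c : ℝ, 0 < c → c ≤ max α (1 - α) →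
        ⌈Real.log (c * ℓ / x) / -Real.log (max α (1 - α))⌉₊ <
          ⌈Real.log (ℓ / x) / -Real.log (max α (1 - α))⌉₊ := by
      intro c hc hcm
      have hm0 : 0 < max α (1 - α) := hc.trans_le hcm
      have hm1 : max α (1 - α) < 1 := max_lt h1 (by linarith)
      have hlog : 0 < -Real.log (max α (1 - α)) := neg_pos.2 (Real.log_neg hm0 hm1)
      have hlx : 1 < ℓ / x := (one_lt_div hx).2 hl
      have ha : 0 < Real.log (ℓ / x) / -Real.log (max α (1 - α)) :=
        div_pos (Real.log_pos hlx) hlog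
      have hle : Real.log (c * ℓ / x) / -Real.log (max α (1 - α)) + 1 ≤
          Real.log (ℓ / x) / -Real.log (max α (1 - α)) := by
        rw [div_add_one hlog.ne', div_le_div_iff_of_pos_right hlog, mul_div_assoc,
          Real.log_mul hc.ne' (by positivity)]
        have := Real.log_le_log hc hcm
        linarith
      rw [Nat.lt_ceil]
      rcases le_or_gt (Real.log (c * ℓ / x) / -Real.log (max α (1 - α))) 0 with h | h
      · rw [Nat.ceil_eq_zero.2 h]
        exact_mod_cast ha
      · exact (Nat.ceil_lt_add_one h.le).trans_le hle
    first
      | exact key α h0 (le_max_left _ _)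
      | exact key (1 - α) (by linarith) (le_max_right _ _)

/-- The list `L` of pairs `(left endpoint, length)` tiles `[u, v)` from left to right. -/
def Tiles : ℝ → List (ℝ × ℝ) → ℝ → Prop
  | u, [], v => u = v
  | u, p :: L, v => p.1 = u ∧ 0 < p.2 ∧ Tiles (u + p.2) L v

/-- The set of left endpoints of a list of tiles. -/
noncomputable def points (L : List (ℝ × ℝ)) : Finset ℝ :=
  (L.map Prod.fst).toFinset

/-- Split every tile of length `M` in proportion `α` and `1 - α`. -/
noncomputable def splitTiles (α M : ℝ) (L : List (ℝ × ℝ)) : List (ℝ × ℝ) :=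
  L.flatMap fun p =>
    if p.2 = M then [(p.1, α * p.2), (p.1 + α * p.2, (1 - α) * p.2)] else [p]

section Tiles

variable {u v w : ℝ} {L L' : List (ℝ × ℝ)}

theorem mem_points {y : ℝ} : y ∈ points L ↔ ∃ p ∈ L, p.1 = y := by
  simp [points]

theorem Tiles.append (h : Tiles u L v) (h' : Tiles v L' w) : Tiles u (L ++ L') w := by
  induction L generalizing u with
  | nil => cases h; exact h'
  | cons p L ih => exact ⟨h.1, h.2.1, ih h.2.2⟩

theorem Tiles.le (h : Tiles u L v) : u ≤ v := by
  induction L generalizing u with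
  | nil => exact le_of_eq h
  | cons p L ih => linarith [h.2.1, ih h.2.2]

theorem Tiles.bounds (h : Tiles u L v) {p : ℝ × ℝ} (hp : p ∈ L) :
    u ≤ p.1 ∧ 0 < p.2 ∧ p.1 + p.2 ≤ v := by
  induction L generalizing u with
  | nil => simp at hp
  | cons q L ih =>
    obtain ⟨h1, h2, h3⟩ := h
    rcases List.mem_cons.1 hp with rfl | hp
    · exact ⟨h1.ge, h2, h1 ▸ h3.le⟩
    · obtain ⟨a, b, c⟩ := ih h3 hp
      exact ⟨by linarith, b, c⟩

theorem Tiles.nodup (h : Tiles u L v) : (L.map Prod.fst).Nodup := by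
  induction L generalizing u with
  | nil => simp
  | cons q L ih =>
    obtain ⟨h1, h2, h3⟩ := h
    rw [List.map_cons, List.nodup_cons]
    refine ⟨fun hq => ?_, ih h3⟩
    obtain ⟨p, hp, hpq⟩ := List.mem_map.1 hq
    linarith [(h3.bounds hp).1]

theorem Tiles.sum_length (h : Tiles u L v) : (L.map Prod.snd).sum = v - u := by
  induction L generalizing u with
  | nil => simp [show u = v from h]
  | cons q L ih =>
    rw [List.map_cons, List.sum_cons, ih h.2.2]
    ring

theorem Tiles.gap (h : Tiles u L v) {p q : ℝ × ℝ} (hp : p ∈ L) (hq : q ∈ L)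
    (hpq : p.1 < q.1) : p.1 + p.2 ≤ q.1 := by
  induction L generalizing u with
  | nil => simp at hp
  | cons r L ih =>
    obtain ⟨h1, h2, h3⟩ := h
    rcases List.mem_cons.1 hp with rfl | hp <;> rcases List.mem_cons.1 hq with rfl | hq
    · exact absurd hpq (lt_irrefl _)
    · rw [h1]
      exact (h3.bounds hq).1
    · linarith [(h3.bounds ‹p ∈ L›).1]
    · exact ih h3 ‹p ∈ L› ‹q ∈ L›

theorem Tiles.exists_next (h : Tiles u L v) {p : ℝ × ℝ} (hp : p ∈ L) :
    p.1 + p.2 = v ∨ ∃ q ∈ L, q.1 = p.1 + p.2 := by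
  induction L generalizing u with
  | nil => simp at hp
  | cons r L ih =>
    obtain ⟨h1, h2, h3⟩ := h
    rcases List.mem_cons.1 hp with rfl | hp
    · cases L with
      | nil => exact Or.inl (h1 ▸ h3)
      | cons q L => exact Or.inr ⟨q, by simp, by rw [h1, h3.1]⟩
    · rcases ih h3 hp with h | ⟨q, hq, h⟩
      · exact Or.inl h
      · exact Or.inr ⟨q, List.mem_cons_of_mem _ hq, h⟩

theorem Tiles.nextPt_eq (h : Tiles u L 1) {p : ℝ × ℝ} (hp : p ∈ L) :
    nextPt (points L) p.1 = p.1 + p.2 := by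
  obtain ⟨-, hp2, hp3⟩ := h.bounds hp
  refine IsLeast.csInf_eq ⟨?_, ?_⟩
  · rcases h.exists_next hp with h | ⟨q, hq, h⟩
    · exact Or.inr h
    · exact Or.inl ⟨mem_points.2 ⟨q, hq, h⟩, by linarith⟩
  · rintro z (⟨hz, hpz⟩ | rfl)
    · obtain ⟨q, hq, rfl⟩ := mem_points.1 hz
      exact h.gap hp hq hpz
    · exact hp3

theorem Tiles.isGreatest_maxLen (h : Tiles u L 1) (hL : L ≠ []) :
    IsGreatest {l | ∃ p ∈ L, p.2 = l} (maxLen (points L)) := by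
  have himg : (fun y => nextPt (points L) y - y) '' (points L : Set ℝ) =
      {l | ∃ p ∈ L, p.2 = l} := by
    ext l
    constructor
    · rintro ⟨y, hy, rfl⟩
      obtain ⟨p, hp, rfl⟩ := mem_points.1 (Finset.mem_coe.1 hy)
      exact ⟨p, hp, by simp [h.nextPt_eq hp]⟩
    · rintro ⟨p, hp, rfl⟩
      exact ⟨p.1, Finset.mem_coe.2 (mem_points.2 ⟨p, hp, rfl⟩), by simp [h.nextPt_eq hp]⟩
  have hfin : {l | ∃ p ∈ L, p.2 = l}.Finite := himg ▸ (Finset.finite_toSet _).image _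
  have hne : {l | ∃ p ∈ L, p.2 = l}.Nonempty := by
    obtain ⟨p, hp⟩ := List.exists_mem_of_ne_nil _ hL
    exact ⟨p.2, p, hp, rfl⟩
  rw [maxLen, himg]
  exact ⟨hne.csSup_mem hfin, fun l hl => le_csSup hfin.bddAbove hl⟩

theorem Tiles.alphaRefine_points (h : Tiles u L 1) (α : ℝ) :
    alphaRefine α (points L) = points (splitTiles α (maxLen (points L)) L) := by
  ext y
  simp only [alphaRefine, Finset.mem_union, Finset.mem_image, Finset.mem_filter, mem_points,
    splitTiles, List.mem_flatMap]
  constructor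
  · rintro (⟨p, hp, rfl⟩ | ⟨_, ⟨⟨p, hp, rfl⟩, hM⟩, rfl⟩)
    · by_cases hM : p.2 = maxLen (points L)
      · exact ⟨(p.1, α * p.2), ⟨p, hp, by simp [hM]⟩, rfl⟩
      · exact ⟨p, ⟨p, hp, by simp [hM]⟩, rfl⟩
    · rw [h.nextPt_eq hp, add_sub_cancel_left] at *
      exact ⟨(p.1 + α * p.2, (1 - α) * p.2), ⟨p, hp, by simp [hM]⟩, rfl⟩
  · rintro ⟨q, ⟨p, hp, hq⟩, rfl⟩
    split_ifs at hq with hM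
    · simp only [List.mem_cons, List.not_mem_nil, or_false] at hq
      rcases hq with rfl | rfl
      · exact Or.inl ⟨p, hp, rfl⟩
      · refine Or.inr ⟨p.1, ⟨⟨p, hp, rfl⟩, ?_⟩, ?_⟩ <;>
          simp [h.nextPt_eq hp, hM]
    · simp only [List.mem_cons, List.not_mem_nil, or_false] at hq
      exact Or.inl ⟨p, hp, by rw [hq]⟩

theorem length_le_length_splitTiles (α M : ℝ) : L.length ≤ (splitTiles α M L).length := by
  induction L with
  | nil => simp [splitTiles]
  | cons p L ih =>
    simp only [splitTiles, List.flatMap_cons, List.length_append, List.length_cons] at ih ⊢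
    split_ifs <;> simp only [List.length_cons, List.length_nil] <;> omega

theorem length_lt_length_splitTiles (α : ℝ) {p : ℝ × ℝ} (hp : p ∈ L) :
    L.length < (splitTiles α p.2 L).length := by
  obtain ⟨s, t, rfl⟩ := List.append_of_mem hp
  have hs := length_le_length_splitTiles (L := s) α p.2
  have ht := length_le_length_splitTiles (L := t) α p.2
  simp only [splitTiles, List.flatMap_append, List.flatMap_cons, List.length_append,
    List.length_cons, if_true, List.length_nil] at hs ht ⊢
  omega

end Tiles

section Leaves

variable {α x u ℓ : ℝ}

theorem leaves_of_le (h : ℓ ≤ x) : leaves α x u ℓ = [(u, ℓ)] := by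
  rw [leaves, dif_neg fun h' => absurd h'.2.2.2 h.not_gt]

theorem leaves_of_lt (h0 : 0 < α) (h1 : α < 1) (hx : 0 < x) (h : x < ℓ) :
    leaves α x u ℓ = leaves α x u (α * ℓ) ++ leaves α x (u + α * ℓ) ((1 - α) * ℓ) := by
  rw [leaves, dif_pos ⟨h0, h1, hx, h⟩]

/-- Induction along the construction of `leaves`. -/
theorem leaves_induction (h0 : 0 < α) (h1 : α < 1) (hx : 0 < x) {motive : ℝ → ℝ → Prop}
    (leaf : ∀ u ℓ, ℓ ≤ x → motive u ℓ)
    (node : ∀ u ℓ, x < ℓ → motive u (α * ℓ) → motive (u + α * ℓ) ((1 - α) * ℓ) → motive u ℓ)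
    (u ℓ : ℝ) : motive u ℓ := by
  induction u, ℓ using leaves.induct α x with
  | case1 u ℓ h ih1 ih2 => exact node u ℓ h.2.2.2 ih1 ih2
  | case2 u ℓ h => exact leaf u ℓ (not_lt.1 fun h' => h ⟨h0, h1, hx, h'⟩)

theorem leaves_tiles (h0 : 0 < α) (h1 : α < 1) (hx : 0 < x) :
    ∀ u ℓ, 0 < ℓ → Tiles u (leaves α x u ℓ) (u + ℓ) := by
  refine leaves_induction h0 h1 hx (fun u ℓ h hl => ?_) fun u ℓ h ih1 ih2 hl => ?_
  · rw [leaves_of_le h]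
    exact ⟨rfl, hl, rfl⟩
  · rw [leaves_of_lt h0 h1 hx h]
    have := (ih1 (by positivity)).append (ih2 (mul_pos (by linarith) hl))
    convert this using 1
    ring

theorem leaves_ne_nil (h0 : 0 < α) (h1 : α < 1) (hx : 0 < x) :
    ∀ u ℓ, leaves α x u ℓ ≠ [] := by
  refine leaves_induction h0 h1 hx (fun u ℓ h => ?_) fun u ℓ h ih1 ih2 => ?_
  · simp [leaves_of_le h]
  · simp [leaves_of_lt h0 h1 hx h, ih1]

theorem length_leaves_pos (h0 : 0 < α) (h1 : α < 1) (hx : 0 < x) (u ℓ : ℝ) :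
    0 < (leaves α x u ℓ).length :=
  List.length_pos_iff.2 (leaves_ne_nil h0 h1 hx u ℓ)

theorem leaves_length_le (h0 : 0 < α) (h1 : α < 1) (hx : 0 < x) :
    ∀ u ℓ, ∀ p ∈ leaves α x u ℓ, p.2 ≤ x := by
  refine leaves_induction h0 h1 hx (fun u ℓ h => ?_) fun u ℓ h ih1 ih2 => ?_
  · simpa [leaves_of_le h] using h
  · rw [leaves_of_lt h0 h1 hx h]
    intro p hp
    exact (List.mem_append.1 hp).elim (ih1 p) (ih2 p)

theorem le_leaves_length (h0 : 0 < α) (h1 : α < 1) (hx : 0 < x) :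
    ∀ u ℓ, min α (1 - α) * x ≤ ℓ → ∀ p ∈ leaves α x u ℓ, min α (1 - α) * x ≤ p.2 := by
  refine leaves_induction h0 h1 hx (fun u ℓ h => ?_) fun u ℓ h ih1 ih2 hl => ?_
  · simp [leaves_of_le h]
  · rw [leaves_of_lt h0 h1 hx h]
    intro p hp
    have hl0 : 0 ≤ ℓ := (hx.trans h).le
    refine (List.mem_append.1 hp).elim (ih1 ?_ p) (ih2 ?_ p)
    · exact mul_le_mul (min_le_left _ _) h.le hx.le h0.le
    · exact mul_le_mul (min_le_right _ _) h.le hx.le (by linarith)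

theorem le_length_leaves_mul (h0 : 0 < α) (h1 : α < 1) (hx : 0 < x) (hl : 0 < ℓ) :
    ℓ ≤ (leaves α x u ℓ).length * x := by
  have hs := (leaves_tiles h0 h1 hx u ℓ hl).sum_length
  have := List.sum_le_card_nsmul ((leaves α x u ℓ).map Prod.snd) x fun l hl => by
    obtain ⟨p, hp, rfl⟩ := List.mem_map.1 hl
    exact leaves_length_le h0 h1 hx u ℓ p hp
  rw [hs, List.length_map, nsmul_eq_mul] at this
  linarith

theorem length_leaves_mul_le (h0 : 0 < α) (h1 : α < 1) (hx : 0 < x) (hxl : x ≤ ℓ) :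
    (leaves α x u ℓ).length * (min α (1 - α) * x) ≤ ℓ := by
  have hs := (leaves_tiles h0 h1 hx u ℓ (hx.trans_le hxl)).sum_length
  have hmin : min α (1 - α) * x ≤ ℓ := by
    have : min α (1 - α) ≤ 1 := (min_le_left _ _).trans h1.le
    nlinarith
  have := List.card_nsmul_le_sum ((leaves α x u ℓ).map Prod.snd) (min α (1 - α) * x)
    fun l hl => by
      obtain ⟨p, hp, rfl⟩ := List.mem_map.1 hl
      exact le_leaves_length h0 h1 hx u ℓ hmin p hp
  rw [hs, List.length_map, nsmul_eq_mul] at this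
  linarith

theorem length_leaves_scale (h0 : 0 < α) (h1 : α < 1) (hx : 0 < x) {c : ℝ} (hc : 0 < c) :
    ∀ u ℓ v, (leaves α x u ℓ).length = (leaves α (c * x) v (c * ℓ)).length := by
  refine leaves_induction h0 h1 hx (fun u ℓ h v => ?_) fun u ℓ h ih1 ih2 v => ?_
  · rw [leaves_of_le h, leaves_of_le (mul_le_mul_of_nonneg_left h hc.le)]
    rfl
  · rw [leaves_of_lt h0 h1 hx h,
      leaves_of_lt h0 h1 (mul_pos hc hx) (mul_lt_mul_of_pos_left h hc),
      List.length_append, List.length_append, ih1 v, ih2 (v + α * (c * ℓ)),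
      mul_left_comm c α, mul_left_comm c (1 - α)]

theorem splitTiles_leaves (h0 : 0 < α) (h1 : α < 1) {M x' : ℝ} (hx' : 0 < x') (hM : x' < M)
    (hMx : M ≤ x) :
    ∀ u ℓ, (∀ p ∈ leaves α x u ℓ, p.2 ≤ M) →
      (∀ p ∈ splitTiles α M (leaves α x u ℓ), p.2 ≤ x') →
      splitTiles α M (leaves α x u ℓ) = leaves α x' u ℓ := by
  have hx : 0 < x := by linarith
  refine leaves_induction h0 h1 hx (fun u ℓ h => ?_) fun u ℓ h ih1 ih2 => ?_
  · rw [leaves_of_le h]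
    intro h2 h3
    by_cases hl : ℓ = M
    · simp only [splitTiles, List.flatMap_cons, List.flatMap_nil, List.append_nil, if_pos hl,
        List.mem_cons, List.not_mem_nil, or_false, forall_eq_or_imp, forall_eq] at h3 ⊢
      rw [leaves_of_lt h0 h1 hx' (by linarith), leaves_of_le h3.1, leaves_of_le h3.2]
      rfl
    · simp only [splitTiles, List.flatMap_cons, List.flatMap_nil, List.append_nil, if_neg hl,
        List.mem_cons, List.not_mem_nil, or_false, forall_eq] at h3 ⊢
      rw [leaves_of_le h3]
  · rw [leaves_of_lt h0 h1 hx h, leaves_of_lt h0 h1 hx' (by linarith)]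
    simp only [splitTiles, List.flatMap_append, List.mem_append] at ih1 ih2 ⊢
    intro h2 h3
    rw [ih1 (fun p hp => h2 p (Or.inl hp)) fun p hp => h3 p (Or.inl hp),
      ih2 (fun p hp => h2 p (Or.inr hp)) fun p hp => h3 p (Or.inr hp)]

/-- Refinement turns a threshold partition into one with a smaller threshold. -/
theorem exists_alphaRefine_eq (h0 : 0 < α) (h1 : α < 1) (hx : 0 < x) (hx1 : x ≤ 1) :
    ∃ x', 0 < x' ∧ x' ≤ 1 ∧
      alphaRefine α (points (leaves α x 0 1)) = points (leaves α x' 0 1) ∧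
      (leaves α x 0 1).length < (leaves α x' 0 1).length := by
  have ht : Tiles 0 (leaves α x 0 1) 1 := by
    simpa using leaves_tiles h0 h1 hx 0 1 one_pos
  set L := leaves α x 0 1 with hL
  obtain ⟨⟨p, hp, hpM⟩, hmax⟩ := ht.isGreatest_maxLen (leaves_ne_nil h0 h1 hx 0 1)
  rw [ht.alphaRefine_points α]
  set M := maxLen (points L)
  have hM0 : 0 < M := hpM ▸ (ht.bounds hp).2.1
  have hMx : M ≤ x := hpM ▸ leaves_length_le h0 h1 hx 0 1 p hp
  have hlt : ∀ q ∈ splitTiles α M L, q.2 < M := by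
    intro q hq
    obtain ⟨r, hr, hqr⟩ := List.mem_flatMap.1 hq
    have hrM : r.2 ≤ M := hmax ⟨r, hr, rfl⟩
    split_ifs at hqr with hrM'
    · simp only [List.mem_cons, List.not_mem_nil, or_false] at hqr
      rcases hqr with rfl | rfl <;> simp only [hrM'] <;> nlinarith
    · simp only [List.mem_cons, List.not_mem_nil, or_false] at hqr
      exact hqr ▸ lt_of_le_of_ne hrM hrM'
  obtain ⟨x', hx'M, hx'0, hx'⟩ : ∃ x' < M, 0 < x' ∧ ∀ q ∈ splitTiles α M L, q.2 ≤ x' := by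
    have hfin : ((fun q : ℝ × ℝ => q.2) '' {q | q ∈ splitTiles α M L}).Finite :=
      (List.finite_toSet _).image _
    have hfin' := hfin.insert (M / 2)
    have hmem := (Set.insert_nonempty (M / 2) _).csSup_mem hfin'
    refine ⟨_, ?_, ?_, fun q hq => le_csSup hfin'.bddAbove (Or.inr ⟨q, hq, rfl⟩)⟩
    · rcases hmem with h | ⟨q, hq, h⟩
      · rw [h]
        linarith
      · rw [← h]
        exact hlt q hq
    · exact (half_pos hM0).trans_le (le_csSup hfin'.bddAbove (Or.inl rfl))
  have heq : splitTiles α M L = leaves α x' 0 1 :=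
    splitTiles_leaves h0 h1 hx'0 hx'M hMx 0 1 (fun q hq => hmax ⟨q, hq, rfl⟩) hx'
  refine ⟨x', hx'0, by linarith, by rw [heq], ?_⟩
  rw [← heq, ← hpM]
  exact length_lt_length_splitTiles α hp

theorem exists_iterate_alphaRefine_eq (h0 : 0 < α) (h1 : α < 1) (n : ℕ) :
    ∃ x, 0 < x ∧ x ≤ 1 ∧ (alphaRefine α)^[n] {0} = points (leaves α x 0 1) ∧
      n < (leaves α x 0 1).length := by
  induction n with
  | zero => exact ⟨1, one_pos, le_rfl, by simp [leaves_of_le, points], by simp [leaves_of_le]⟩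
  | succ n ih =>
    obtain ⟨x, hx, hx1, hP, hn⟩ := ih
    obtain ⟨x', hx', hx1', hP', hn'⟩ := exists_alphaRefine_eq h0 h1 hx hx1
    exact ⟨x', hx', hx1', by rw [Function.iterate_succ_apply', hP, hP'], by omega⟩

end Leaves

section Renewal

open Filter Topology

theorem tendsto_div_const_nhdsGT_zero {c : ℝ} (hc : 0 < c) :
    Tendsto (fun x : ℝ => x / c) (𝓝[>] 0) (𝓝[>] 0) := by
  refine tendsto_nhdsWithin_iff.2 ⟨?_, ?_⟩
  · have : Tendsto (fun x : ℝ => x / c) (𝓝 0) (𝓝 (0 / c)) := tendsto_id.div_const c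
    rw [zero_div] at this
    exact this.mono_left nhdsWithin_le_nhds
  · filter_upwards [self_mem_nhdsWithin] with x hx
    exact div_pos hx hc

variable {a b : ℝ} {Z : ℝ → ℝ}

/-- If `D` satisfies the renewal equation near `0`, then values of `D` close to its upper limit
persist along arbitrarily many steps `x ↦ x / a`. -/
theorem frequently_forall_le_of_renewal {D : ℝ → ℝ} (ha : 0 < a) (hb : 0 < b) (hab : a + b = 1)
    (hD : ∀ᶠ x in 𝓝[>] 0, D x = a * D (x / a) + b * D (x / b)) {s : ℝ}
    (hlt : ∀ t > s, ∀ᶠ x in 𝓝[>] 0, D x < t) (hgt : ∀ t < s, ∃ᶠ x in 𝓝[>] 0, t < D x) (k : ℕ) :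
    ∀ η > 0, ∃ᶠ x in 𝓝[>] 0, ∀ j ≤ k, s - η < D (x / a ^ j) := by
  induction k with
  | zero =>
    intro η hη
    refine (hgt (s - η) (by linarith)).mono fun x hx j hj => ?_
    simpa [Nat.le_zero.1 hj] using hx
  | succ k ih =>
    intro η hη
    have hpow := tendsto_div_const_nhdsGT_zero (pow_pos ha k)
    have hb' := ((tendsto_div_const_nhdsGT_zero hb).comp hpow).eventually
      (hlt (s + a * η) (by nlinarith))
    refine ((ih (a ^ 2 * η) (by positivity)).and_eventually
      ((hpow.eventually hD).and hb')).mono ?_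
    rintro x ⟨hx, hDx, hbx⟩ j hj
    rcases Nat.le_succ_iff.1 hj with hj | rfl
    · have : a ^ 2 * η ≤ η :=
        mul_le_of_le_one_left hη.le (pow_le_one₀ ha.le (by linarith))
      linarith [hx j hj]
    · have h1 := hx k le_rfl
      simp only [Function.comp_apply] at hbx
      rw [hDx, div_div, ← pow_succ] at h1
      have h2 : b * D (x / a ^ k / b) < b * (s + a * η) := mul_lt_mul_of_pos_left hbx hb
      have h3 : a * (s - η) < a * D (x / a ^ (k + 1)) := by
        have hb1 : b = 1 - a := by linarith
        rw [hb1] at h1 h2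
        nlinarith
      exact lt_of_mul_lt_mul_left h3 ha.le

theorem eventually_sub_lt_of_renewal (ha : 0 < a) (hb : 0 < b) (hab : a + b = 1) {C : ℝ}
    (hC : ∀ᶠ x in 𝓝[>] 0, |Z x| ≤ C)
    (hZ : ∀ᶠ x in 𝓝[>] 0, Z x = a * Z (x / a) + b * Z (x / b)) {ε : ℝ} (hε : 0 < ε) :
    ∀ᶠ x in 𝓝[>] 0, Z x - Z (x / a) < ε := by
  have hta := tendsto_div_const_nhdsGT_zero ha
  have hDC : ∀ᶠ x in 𝓝[>] 0, |Z x - Z (x / a)| ≤ 2 * C := by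
    filter_upwards [hC, hta.eventually hC] with x h1 h2
    exact (abs_sub _ _).trans (by linarith)
  have hbdd : IsBoundedUnder (· ≤ ·) (𝓝[>] 0) fun x => Z x - Z (x / a) :=
    ⟨2 * C, eventually_map.2 (hDC.mono fun x hx => (abs_le.1 hx).2)⟩
  have hbdd' : IsBoundedUnder (· ≥ ·) (𝓝[>] 0) fun x => Z x - Z (x / a) :=
    ⟨-(2 * C), eventually_map.2 (hDC.mono fun x hx => (abs_le.1 hx).1)⟩
  set s := limsup (fun x => Z x - Z (x / a)) (𝓝[>] 0)
  suffices hs : s ≤ 0 from eventually_lt_of_limsup_lt (hs.trans_lt hε) hbdd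
  by_contra! hs
  have hD : ∀ᶠ x in 𝓝[>] 0, Z x - Z (x / a) =
      a * (Z (x / a) - Z (x / a / a)) + b * (Z (x / b) - Z (x / b / a)) := by
    filter_upwards [hZ, hta.eventually hZ] with x h1 h2
    rw [div_right_comm x b a]
    linear_combination h1 - h2
  obtain ⟨K, hK⟩ := exists_nat_gt (2 * C / (s / 2))
  rw [div_lt_iff₀ (by linarith)] at hK
  have hfreq := frequently_forall_le_of_renewal (D := fun x => Z x - Z (x / a)) ha hb hab hD
    (s := s) (fun t ht => eventually_lt_of_limsup_lt ht hbdd)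
    (fun t ht => frequently_lt_of_lt_limsup hbdd'.isCoboundedUnder_le ht) K (s / 2)
    (by linarith)
  obtain ⟨x, hx, hx1, hx2⟩ := (hfreq.and_eventually
    (hC.and ((tendsto_div_const_nhdsGT_zero (pow_pos ha K)).eventually hC))).exists
  have htel : ∑ j ∈ Finset.range K, (Z (x / a ^ j) - Z (x / a ^ j / a)) =
      Z x - Z (x / a ^ K) := by
    have := Finset.sum_range_sub' (fun j => Z (x / a ^ j)) K
    simpa [pow_succ, div_div] using this
  have hsum : K * (s / 2) ≤ ∑ j ∈ Finset.range K, (Z (x / a ^ j) - Z (x / a ^ j / a)) := by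
    have := Finset.card_nsmul_le_sum (Finset.range K)
      (fun j => Z (x / a ^ j) - Z (x / a ^ j / a)) (s / 2) fun j hj => by
        have := hx j (Finset.mem_range.1 hj).le
        linarith
    simpa using this
  linarith [(abs_le.1 hx1).2, (abs_le.1 hx2).1]

/-- A bounded solution of the renewal equation is asymptotically invariant under `x ↦ x / a`. -/
theorem tendsto_sub_of_renewal (ha : 0 < a) (hb : 0 < b) (hab : a + b = 1) {C : ℝ}
    (hC : ∀ᶠ x in 𝓝[>] 0, |Z x| ≤ C)
    (hZ : ∀ᶠ x in 𝓝[>] 0, Z x = a * Z (x / a) + b * Z (x / b)) :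
    Tendsto (fun x => Z x - Z (x / a)) (𝓝[>] 0) (𝓝 0) := by
  rw [Metric.tendsto_nhds]
  intro ε hε
  have h2 := eventually_sub_lt_of_renewal (Z := fun x => -Z x) ha hb hab
    (hC.mono fun x hx => by simpa using hx)
    (hZ.mono fun x hx => by linarith) hε
  filter_upwards [eventually_sub_lt_of_renewal ha hb hab hC hZ hε, h2] with x h1 h2
  rw [Real.dist_eq, sub_zero, abs_lt]
  constructor <;> linarith

end Renewal

section Equidistribution

open Filter Topology

variable {α : ℝ}

/-- The number of pieces of the threshold partition of `[0, 1)`. -/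
noncomputable def leafCount (α x : ℝ) : ℝ := (leaves α x 0 1).length

theorem leafCount_pos (h0 : 0 < α) (h1 : α < 1) {x : ℝ} (hx : 0 < x) : 0 < leafCount α x :=
  Nat.cast_pos.2 (length_leaves_pos h0 h1 hx 0 1)

theorem length_leaves_eq_leafCount (h0 : 0 < α) (h1 : α < 1) {x ℓ : ℝ} (hx : 0 < x)
    (hl : 0 < ℓ) (u : ℝ) : ((leaves α x u ℓ).length : ℝ) = leafCount α (x / ℓ) := by
  rw [leafCount, length_leaves_scale h0 h1 hx (inv_pos.2 hl) u ℓ 0, inv_mul_cancel₀ hl.ne',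
    inv_mul_eq_div]

theorem leafCount_eq (h0 : 0 < α) (h1 : α < 1) {x : ℝ} (hx : 0 < x) (hx1 : x < 1) :
    leafCount α x = leafCount α (x / α) + leafCount α (x / (1 - α)) := by
  rw [← length_leaves_eq_leafCount h0 h1 hx h0 0,
    ← length_leaves_eq_leafCount h0 h1 hx (sub_pos.2 h1) (0 + α), leafCount,
    leaves_of_lt h0 h1 hx hx1]
  simp

theorem eventually_mem_Ioo_nhdsGT_zero {c : ℝ} (hc : 0 < c) :
    ∀ᶠ x : ℝ in 𝓝[>] 0, 0 < x ∧ x < c :=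
  Ioo_mem_nhdsGT hc

theorem eventually_renewal_leafCount (h0 : 0 < α) (h1 : α < 1) :
    ∀ᶠ x in 𝓝[>] 0, x * leafCount α x =
      α * (x / α * leafCount α (x / α)) +
        (1 - α) * (x / (1 - α) * leafCount α (x / (1 - α))) := by
  filter_upwards [eventually_mem_Ioo_nhdsGT_zero one_pos] with x hx
  have : 1 - α ≠ 0 := by linarith
  rw [leafCount_eq h0 h1 hx.1 hx.2]
  field_simp

theorem eventually_abs_mul_leafCount_le (h0 : 0 < α) (h1 : α < 1) :
    ∀ᶠ x in 𝓝[>] 0, |x * leafCount α x| ≤ 1 / min α (1 - α) := by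
  have hm : 0 < min α (1 - α) := lt_min h0 (by linarith)
  filter_upwards [eventually_mem_Ioo_nhdsGT_zero one_pos] with x hx
  rw [abs_of_pos (mul_pos hx.1 (leafCount_pos h0 h1 hx.1)), le_div_iff₀ hm]
  have := length_leaves_mul_le (u := 0) h0 h1 hx.1 hx.2.le
  rw [leafCount]
  linarith

theorem tendsto_mul_leafCount_sub_left (h0 : 0 < α) (h1 : α < 1) :
    Tendsto (fun x => x * leafCount α x - x / α * leafCount α (x / α)) (𝓝[>] 0) (𝓝 0) :=
  tendsto_sub_of_renewal (Z := fun x => x * leafCount α x) h0 (sub_pos.2 h1) (by ring)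
    (eventually_abs_mul_leafCount_le h0 h1) (eventually_renewal_leafCount h0 h1)

theorem tendsto_mul_leafCount_sub_right (h0 : 0 < α) (h1 : α < 1) :
    Tendsto (fun x => x * leafCount α x - x / (1 - α) * leafCount α (x / (1 - α)))
      (𝓝[>] 0) (𝓝 0) :=
  tendsto_sub_of_renewal (Z := fun x => x * leafCount α x) (sub_pos.2 h1) h0 (by ring)
    (eventually_abs_mul_leafCount_le h0 h1)
    ((eventually_renewal_leafCount h0 h1).mono fun x hx => by rw [hx, add_comm])

/-- The proportion of pieces produced inside a piece of length `ℓ` tends to `ℓ`. -/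
def HasAsymptoticShare (α ℓ : ℝ) : Prop :=
  Tendsto (fun x => leafCount α (x / ℓ) / leafCount α x) (𝓝[>] 0) (𝓝 ℓ)

theorem hasAsymptoticShare_one (h0 : 0 < α) (h1 : α < 1) : HasAsymptoticShare α 1 := by
  refine tendsto_const_nhds.congr' ?_
  filter_upwards [self_mem_nhdsWithin] with x hx
  rw [div_one, div_self (leafCount_pos h0 h1 hx).ne']

theorem HasAsymptoticShare.mul (h0 : 0 < α) (h1 : α < 1) {c ℓ : ℝ} (hc : 0 < c) (hl : 0 < ℓ)
    (h : HasAsymptoticShare α ℓ)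
    (hsub : Tendsto (fun x => x * leafCount α x - x / c * leafCount α (x / c)) (𝓝[>] 0) (𝓝 0)) :
    HasAsymptoticShare α (c * ℓ) := by
  have hinv : Tendsto (fun x => leafCount α (x / c) / leafCount α x) (𝓝[>] 0) (𝓝 c) := by
    rw [tendsto_iff_norm_sub_tendsto_zero]
    have hsub' := (hsub.norm.const_mul c)
    rw [norm_zero, mul_zero] at hsub'
    refine squeeze_zero' (Eventually.of_forall fun _ => norm_nonneg _) ?_ hsub'
    filter_upwards [self_mem_nhdsWithin] with x hx
    have hx : 0 < x := hx
    have hN := leafCount_pos h0 h1 hx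
    have hxN : 1 ≤ x * leafCount α x := by
      have := le_length_leaves_mul (u := 0) h0 h1 hx one_pos
      rw [leafCount]
      linarith
    have heq : leafCount α (x / c) / leafCount α x - c =
        -(c * (x * leafCount α x - x / c * leafCount α (x / c))) / (x * leafCount α x) := by
      field_simp
      ring
    rw [heq, norm_div, norm_neg, norm_mul, Real.norm_of_nonneg hc.le,
      Real.norm_of_nonneg (zero_le_one.trans hxN)]
    exact div_le_self (by positivity) hxN
  have := (hinv.comp (tendsto_div_const_nhdsGT_zero hl)).mul h
  refine this.congr' ?_
  filter_upwards [self_mem_nhdsWithin] with x hx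
  have hN := (leafCount_pos h0 h1 (div_pos hx hl)).ne'
  simp only [Function.comp_apply]
  rw [div_mul_div_cancel₀ hN, div_div, mul_comm c ℓ]

/-- The sum of `f` over the left endpoints of a list of tiles. -/
noncomputable def tileSum (f : ℝ → ℝ) (L : List (ℝ × ℝ)) : ℝ := (L.map fun p => f p.1).sum

theorem tileSum_append (f : ℝ → ℝ) (L L' : List (ℝ × ℝ)) :
    tileSum f (L ++ L') = tileSum f L + tileSum f L' := by
  simp [tileSum]

theorem abs_tileSum_sub_le {f : ℝ → ℝ} {c ε : ℝ} (L : List (ℝ × ℝ))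
    (h : ∀ p ∈ L, |f p.1 - c| ≤ ε) : |tileSum f L - c * L.length| ≤ ε * L.length := by
  induction L with
  | nil => simp [tileSum]
  | cons p L ih =>
    have h1 := h p (by simp)
    have h2 := ih fun q hq => h q (by simp [hq])
    rw [abs_le] at h1 h2 ⊢
    simp only [tileSum, List.map_cons, List.sum_cons, List.length_cons, Nat.cast_add,
      Nat.cast_one] at h1 h2 ⊢
    constructor <;> linarith

theorem eventually_abs_tileSum_sub_le_of_short (h0 : 0 < α) (h1 : α < 1) {f : ℝ → ℝ}
    {u ℓ ε : ℝ} (hε : 0 < ε) (hl : 0 < ℓ) (hf : ContinuousOn f (Set.Icc u (u + ℓ)))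
    (hosc : ∀ y ∈ Set.Icc u (u + ℓ), |f y - f u| ≤ ε) (hs : HasAsymptoticShare α ℓ) :
    ∀ᶠ x in 𝓝[>] 0, |tileSum f (leaves α x u ℓ) / leafCount α x - ∫ y in u..u + ℓ, f y| ≤
      3 * ε * ℓ := by
  have hint : |(∫ y in u..u + ℓ, f y) - f u * ℓ| ≤ ε * ℓ := by
    have hle : u ≤ u + ℓ := by linarith
    have hi : IntervalIntegrable f MeasureTheory.volume u (u + ℓ) :=
      hf.intervalIntegrable_of_Icc hle
    have hb := intervalIntegral.norm_integral_le_of_norm_le_const (a := u) (b := u + ℓ)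
      (f := fun y => f y - f u) (C := ε) fun y hy => by
        rw [Set.uIoc_of_le hle] at hy
        exact hosc y (Set.Ioc_subset_Icc_self hy)
    rw [intervalIntegral.integral_sub hi intervalIntegrable_const,
      intervalIntegral.integral_const, add_sub_cancel_left, abs_of_pos hl, smul_eq_mul,
      mul_comm ℓ, Real.norm_eq_abs] at hb
    exact hb
  have hlim : Tendsto (fun x => ε * (leafCount α (x / ℓ) / leafCount α x) +
      |f u| * |leafCount α (x / ℓ) / leafCount α x - ℓ|) (𝓝[>] 0)
      (𝓝 (ε * ℓ + |f u| * |ℓ - ℓ|)) :=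
    (hs.const_mul ε).add ((hs.sub_const ℓ).abs.const_mul _)
  rw [sub_self, abs_zero, mul_zero, add_zero] at hlim
  filter_upwards [self_mem_nhdsWithin,
    hlim.eventually_lt_const (show ε * ℓ < 2 * (ε * ℓ) by nlinarith [mul_pos hε hl])] with x hx hlt
  have hN := leafCount_pos h0 h1 hx
  have hsum := abs_tileSum_sub_le (f := f) (c := f u) (ε := ε) (leaves α x u ℓ) fun p hp => by
    obtain ⟨hp1, hp2, hp3⟩ := (leaves_tiles h0 h1 hx u ℓ hl).bounds hp
    exact hosc p.1 ⟨hp1, by linarith⟩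
  rw [length_leaves_eq_leafCount h0 h1 hx hl] at hsum
  set r := leafCount α (x / ℓ) / leafCount α x with hr
  have hrN : leafCount α (x / ℓ) = r * leafCount α x := by rw [hr, div_mul_cancel₀ _ hN.ne']
  have hquot : |tileSum f (leaves α x u ℓ) / leafCount α x - f u * r| ≤ ε * r := by
    rw [hrN, ← mul_assoc, ← mul_assoc] at hsum
    rw [← mul_le_mul_iff_left₀ hN, ← abs_of_pos hN, ← abs_mul, abs_of_pos hN, sub_mul,
      div_mul_cancel₀ _ hN.ne']
    exact hsum
  have h3 : |f u * r - f u * ℓ| = |f u| * |r - ℓ| := by rw [← mul_sub, abs_mul]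
  calc _ = |(tileSum f (leaves α x u ℓ) / leafCount α x - f u * r) + (f u * r - f u * ℓ) -
        ((∫ y in u..u + ℓ, f y) - f u * ℓ)| := by ring_nf
    _ ≤ |tileSum f (leaves α x u ℓ) / leafCount α x - f u * r| + |f u * r - f u * ℓ| +
        |(∫ y in u..u + ℓ, f y) - f u * ℓ| :=
      (abs_sub _ _).trans (by gcongr; exact abs_add_le _ _)
    _ ≤ 3 * ε * ℓ := by linarith

theorem eventually_abs_tileSum_sub_le (h0 : 0 < α) (h1 : α < 1) {f : ℝ → ℝ}
    (hf : ContinuousOn f (Set.Icc 0 1)) {ε δ : ℝ} (hε : 0 < ε)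
    (hosc : ∀ y ∈ Set.Icc (0 : ℝ) 1, ∀ z ∈ Set.Icc (0 : ℝ) 1, |y - z| < δ → |f y - f z| ≤ ε)
    (k : ℕ) :
    ∀ u ℓ, 0 ≤ u → 0 < ℓ → u + ℓ ≤ 1 → max α (1 - α) ^ k * ℓ < δ → HasAsymptoticShare α ℓ →
      ∀ᶠ x in 𝓝[>] 0, |tileSum f (leaves α x u ℓ) / leafCount α x - ∫ y in u..u + ℓ, f y| ≤
        3 * ε * ℓ := by
  have h1' : 0 < 1 - α := sub_pos.2 h1
  induction k with
  | zero =>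
    intro u ℓ hu hl hul hk hs
    have hsub : Set.Icc u (u + ℓ) ⊆ Set.Icc 0 1 := Set.Icc_subset_Icc hu hul
    refine eventually_abs_tileSum_sub_le_of_short h0 h1 hε hl (hf.mono hsub)
      (fun y hy => hosc y (hsub hy) u (hsub (by simp [hl.le])) ?_) hs
    rw [abs_of_nonneg (by linarith [hy.1])]
    linarith [hy.2]
  | succ k ih =>
    intro u ℓ hu hl hul hk hs
    have hm : 0 < max α (1 - α) := h0.trans_le (le_max_left _ _)
    have hstep : ∀ c, c ≤ max α (1 - α) → max α (1 - α) ^ k * (c * ℓ) < δ := by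
      intro c hc
      refine lt_of_le_of_lt ?_ hk
      rw [pow_succ, mul_assoc]
      gcongr
    have hαl : 0 < α * ℓ := mul_pos h0 hl
    have hβl : 0 < (1 - α) * ℓ := mul_pos h1' hl
    have hend : u + α * ℓ + (1 - α) * ℓ = u + ℓ := by ring
    have hA := ih u (α * ℓ) hu hαl (by linarith) (hstep α (le_max_left _ _))
      (hs.mul h0 h1 h0 hl (tendsto_mul_leafCount_sub_left h0 h1))
    have hB := ih (u + α * ℓ) ((1 - α) * ℓ) (by linarith) hβl (by linarith)
      (hstep (1 - α) (le_max_right _ _))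
      (hs.mul h0 h1 h1' hl (tendsto_mul_leafCount_sub_right h0 h1))
    rw [hend] at hB
    have hintA : IntervalIntegrable f MeasureTheory.volume u (u + α * ℓ) :=
      (hf.mono (Set.Icc_subset_Icc hu (by linarith))).intervalIntegrable_of_Icc (by linarith)
    have hintB : IntervalIntegrable f MeasureTheory.volume (u + α * ℓ) (u + ℓ) :=
      (hf.mono (Set.Icc_subset_Icc (by linarith) hul)).intervalIntegrable_of_Icc (by linarith)
    rw [← intervalIntegral.integral_add_adjacent_intervals hintA hintB]
    filter_upwards [hA, hB, eventually_mem_Ioo_nhdsGT_zero hl] with x hA hB hx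
    rw [leaves_of_lt h0 h1 hx.1 hx.2, tileSum_append, add_div]
    rw [abs_le] at hA hB ⊢
    constructor <;> linarith

/-- The threshold partitions are uniformly distributed as the threshold tends to `0`. -/
theorem tendsto_tileSum_div (h0 : 0 < α) (h1 : α < 1) {f : ℝ → ℝ}
    (hf : ContinuousOn f (Set.Icc 0 1)) :
    Tendsto (fun x => tileSum f (leaves α x 0 1) / leafCount α x) (𝓝[>] 0)
      (𝓝 (∫ x in (0 : ℝ)..1, f x)) := by
  rw [Metric.tendsto_nhds]
  intro ε hε
  have huc := isCompact_Icc.uniformContinuousOn_of_continuous hf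
  obtain ⟨δ, hδ, hosc⟩ := Metric.uniformContinuousOn_iff.1 huc (ε / 4) (by linarith)
  have hm0 : 0 ≤ max α (1 - α) := h0.le.trans (le_max_left _ _)
  obtain ⟨k, hk⟩ := exists_pow_lt_of_lt_one hδ (max_lt h1 (by linarith : 1 - α < 1))
  have := eventually_abs_tileSum_sub_le h0 h1 hf (ε := ε / 4) (δ := δ) (by linarith)
    (fun y hy z hz hyz => (hosc y hy z hz hyz).le) k 0 1 le_rfl one_pos (by simp)
    (by simpa using hk) (hasAsymptoticShare_one h0 h1)
  filter_upwards [this] with x hx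
  rw [zero_add] at hx
  rw [Real.dist_eq]
  linarith

end Equidistribution

/-- **Kakutani's theorem.** Let `α ∈ (0,1)` and let `Pₙ` be the `n`-th
successive `α`-refinement of the trivial partition `{0}` of `[0,1)`.  Then `(Pₙ)` is
uniformly distributed: for every continuous `f : [0,1] → ℝ`,
`(1/|Pₙ|) Σ_{y ∈ Pₙ} f(y) → ∫₀¹ f(x) dx` as `n → ∞`. -/
theorem stmt_17 (α : ℝ) (hα0 : 0 < α) (hα1 : α < 1) :
    ∀ f : ℝ → ℝ, ContinuousOn f (Set.Icc 0 1) →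
      Filter.Tendsto
        (fun n : ℕ => (1 / (((alphaRefine α)^[n] {0}).card : ℝ)) *
          ∑ y ∈ (alphaRefine α)^[n] {0}, f y)
        Filter.atTop (nhds (∫ x in (0:ℝ)..1, f x)) := by
  intro f hf
  choose x hx hx1 hP hn using exists_iterate_alphaRefine_eq hα0 hα1
  have hm : 0 < min α (1 - α) := lt_min hα0 (by linarith)
  have hx0 : Filter.Tendsto x Filter.atTop (nhdsWithin 0 (Set.Ioi 0)) := by
    refine tendsto_nhdsWithin_iff.2 ⟨?_, Filter.Eventually.of_forall hx⟩
    have hlim := (tendsto_one_div_add_atTop_nhds_zero_nat (𝕜 := ℝ)).const_mul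
      (1 / min α (1 - α))
    rw [mul_zero] at hlim
    refine squeeze_zero (fun n => (hx n).le) (fun n => ?_) hlim
    have hle := length_leaves_mul_le (u := 0) hα0 hα1 (hx n) (hx1 n)
    have hcast : (n : ℝ) + 1 ≤ (leaves α (x n) 0 1).length := by exact_mod_cast hn n
    rw [div_mul_div_comm, one_mul, le_div_iff₀ (by positivity)]
    have : 0 < min α (1 - α) * x n := mul_pos hm (hx n)
    nlinarith
  refine ((tendsto_tileSum_div hα0 hα1 hf).comp hx0).congr fun n => ?_
  have hnd := (leaves_tiles hα0 hα1 (hx n) 0 1 one_pos).nodup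
  rw [hP n, points, List.sum_toFinset _ hnd, List.toFinset_card_of_nodup hnd, List.length_map,
    List.map_map, Function.comp_apply, tileSum, leafCount, one_div, inv_mul_eq_div]
  rfl
end

section
/- Let ρ be a nontrivial finite partition of [0,1) and let ρ^n ω be the n-th successive ρ-refinement of the trivial partition ω = {0} of [0,1). Then the sequence of partitions (ρ^n ω) is uniformly distributed: for every continuous function f : [0,1] → ℝ, (1/|ρ^n ω|) Σ_{y ∈ ρ^n ω} f(y) → ∫_0^1 f(x) dx as n → ∞. -/
/-- The `ρ`-refinement, where `ρ` is given by `0 = r 0 < r 1 < ⋯ < r p = 1` with `p ≥ 2`: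
each interval `[a, b)` of `P` of maximal length is subdivided positively homothetically to
`ρ` by adding the points `a + r j · (b − a)` for `j = 1, …, p − 1`. -/
noncomputable def rhoRefine (p : ℕ) (r : ℕ → ℝ) (P : Finset ℝ) : Finset ℝ :=
  P ∪ (P.filter fun y => nextPt P y - y = maxLen P).biUnion
    fun y => (Finset.Ico 1 p).image fun j => y + r j * (nextPt P y - y)

open Filter Topology Finset

/-- The points `0 = r 0 < r 1 < ⋯ < r p = 1` with `p ≥ 2` determine a nontrivial partition. -/
structure IsSubdivision (p : ℕ) (r : ℕ → ℝ) : Prop where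
  two_le : 2 ≤ p
  zero : r 0 = 0
  one : r p = 1
  mono : ∀ j k : ℕ, j < k → k ≤ p → r j < r k

namespace IsSubdivision

variable {p : ℕ} {r : ℕ → ℝ} (h : IsSubdivision p r)

include h

lemma le_of_le {j k : ℕ} (hjk : j ≤ k) (hk : k ≤ p) : r j ≤ r k := by
  rcases hjk.eq_or_lt with rfl | hlt
  · exact le_rfl
  · exact (h.mono j k hlt hk).le

lemma nonneg {j : ℕ} (hj : j ≤ p) : 0 ≤ r j := h.zero ▸ h.le_of_le (Nat.zero_le j) hj

lemma le_one {j : ℕ} (hj : j ≤ p) : r j ≤ 1 := h.one ▸ h.le_of_le hj le_rfl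

lemma lt_one {j : ℕ} (hj : j < p) : r j < 1 := h.one ▸ h.mono j p hj le_rfl

lemma ratio_pos {i : ℕ} (hi : i < p) : 0 < r (i + 1) - r i :=
  sub_pos.2 (h.mono i (i + 1) (Nat.lt_succ_self i) hi)

lemma ratio_lt_one {i : ℕ} (hi : i < p) : r (i + 1) - r i < 1 := by
  have h2 := h.two_le
  rcases Nat.eq_zero_or_pos i with rfl | h0
  · have := h.lt_one (j := 1) (by omega)
    simp only [zero_add, h.zero]; linarith
  · have := h.mono 0 i h0 hi.le
    have := h.le_one (j := i + 1) hi
    have := h.zero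
    linarith

lemma sum_ratio : ∑ i ∈ range p, (r (i + 1) - r i) = 1 := by
  rw [Finset.sum_range_sub, h.zero, h.one, sub_zero]

lemma exists_ratio_le : ∃ c : ℝ, 0 < c ∧ c < 1 ∧ ∀ i < p, r (i + 1) - r i ≤ c := by
  have h2 := h.two_le
  obtain ⟨m, hm, hmax⟩ := Finset.exists_max_image (range p) (fun i => r (i + 1) - r i)
    ⟨0, by simp; omega⟩
  exact ⟨_, h.ratio_pos (mem_range.1 hm), h.ratio_lt_one (mem_range.1 hm),
    fun i hi => hmax i (mem_range.2 hi)⟩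

lemma exists_le_ratio : ∃ b : ℝ, 0 < b ∧ ∀ i < p, b ≤ r (i + 1) - r i := by
  have h2 := h.two_le
  obtain ⟨m, hm, hmin⟩ := Finset.exists_min_image (range p) (fun i => r (i + 1) - r i)
    ⟨0, by simp; omega⟩
  exact ⟨_, h.ratio_pos (mem_range.1 hm), fun i hi => hmin i (mem_range.2 hi)⟩

/-- Induction on the intervals `[a, a + l)` obtained by iterated subdivision, stopping as soon
as the length is at most `s`. -/
lemma interval_induction {s : ℝ} (hs : 0 < s) {P : ℝ → ℝ → Prop}
    (leaf : ∀ a l, l ≤ s → P a l)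
    (node : ∀ a l, s < l → (∀ i < p, P (a + r i * l) ((r (i + 1) - r i) * l)) → P a l)
    (a l : ℝ) : P a l := by
  obtain ⟨c, hc0, hc1, hc⟩ := h.exists_ratio_le
  have key : ∀ k : ℕ, ∀ a l, c ^ k * l ≤ s → P a l := by
    intro k
    induction k with
    | zero => intro a l hl; exact leaf a l (by simpa using hl)
    | succ k ih =>
      intro a l hl
      rcases le_or_gt l s with hls | hls
      · exact leaf a l hls
      · refine node a l hls fun i hi => ih _ _ (le_trans ?_ hl)
        have : (r (i + 1) - r i) * l ≤ c * l :=
          mul_le_mul_of_nonneg_right (hc i hi) (hs.trans hls).le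
        calc c ^ k * ((r (i + 1) - r i) * l) ≤ c ^ k * (c * l) := by gcongr
          _ = c ^ (k + 1) * l := by ring
  have ht : Tendsto (fun k : ℕ => c ^ k * l) atTop (𝓝 0) := by
    simpa using (tendsto_pow_atTop_nhds_zero_of_lt_one hc0.le hc1).mul_const l
  obtain ⟨k, hk⟩ := (ht.eventually_le_const hs).exists
  exact key k a l hk

end IsSubdivision

/-- Approximation of `treeSum` in which at most `k` levels of subdivision are performed. -/
noncomputable def treeSumAux (p : ℕ) (r : ℕ → ℝ) (s : ℝ) (g : ℝ → ℝ) : ℕ → ℝ → ℝ → ℝ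
  | 0, a, _ => g a
  | k + 1, a, l => if l ≤ s then g a else
      ∑ i ∈ range p, treeSumAux p r s g k (a + r i * l) ((r (i + 1) - r i) * l)

/-- The sum of `g` over the left endpoints of the intervals obtained from `[a, a + l)` by
subdividing homothetically to `ρ` as long as the length exceeds `s`. -/
noncomputable def treeSum (p : ℕ) (r : ℕ → ℝ) (s : ℝ) (g : ℝ → ℝ) (a l : ℝ) : ℝ :=
  limUnder atTop fun k => treeSumAux p r s g k a l

namespace IsSubdivision

variable {p : ℕ} {r : ℕ → ℝ} (h : IsSubdivision p r)

lemma treeSumAux_of_le {s l : ℝ} (hl : l ≤ s) (g : ℝ → ℝ) (k : ℕ) (a : ℝ) :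
    treeSumAux p r s g k a l = g a := by
  cases k <;> simp [treeSumAux, hl]

lemma treeSum_of_le {s l : ℝ} (hl : l ≤ s) (g : ℝ → ℝ) (a : ℝ) :
    treeSum p r s g a l = g a := by
  simp only [treeSum, treeSumAux_of_le hl]
  exact tendsto_const_nhds.limUnder_eq

include h

lemma tendsto_treeSumAux {s : ℝ} (hs : 0 < s) (g : ℝ → ℝ) (a l : ℝ) :
    Tendsto (fun k => treeSumAux p r s g k a l) atTop (𝓝 (treeSum p r s g a l)) := by
  refine tendsto_nhds_limUnder ?_
  refine h.interval_induction hs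
    (P := fun a l => ∃ v, Tendsto (fun k => treeSumAux p r s g k a l) atTop (𝓝 v)) ?_ ?_ a l
  · intro a l hl
    simp only [treeSumAux_of_le hl]
    exact ⟨_, tendsto_const_nhds⟩
  · intro a l hl ih
    choose! v hv using ih
    refine ⟨∑ i ∈ range p, v i, (tendsto_add_atTop_iff_nat 1).1 ?_⟩
    simp only [treeSumAux, not_le.2 hl, if_false]
    exact tendsto_finsetSum _ fun i hi => hv i (mem_range.1 hi)

lemma treeSum_of_lt {s : ℝ} (hs : 0 < s) {l : ℝ} (hl : s < l) (g : ℝ → ℝ) (a : ℝ) :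
    treeSum p r s g a l =
      ∑ i ∈ range p, treeSum p r s g (a + r i * l) ((r (i + 1) - r i) * l) := by
  have h1 := (tendsto_add_atTop_iff_nat 1).2 (h.tendsto_treeSumAux hs g a l)
  simp only [treeSumAux, not_le.2 hl, if_false] at h1
  exact tendsto_nhds_unique h1 (tendsto_finsetSum _ fun i _ => h.tendsto_treeSumAux hs g _ _)

lemma treeSum_one_congr {s : ℝ} (hs : 0 < s) (a b l : ℝ) :
    treeSum p r s 1 a l = treeSum p r s 1 b l := by
  refine h.interval_induction hs
    (P := fun a l => ∀ b, treeSum p r s 1 a l = treeSum p r s 1 b l) ?_ ?_ a l b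
  · intro a l hl b
    simp [treeSum_of_le hl]
  · intro a l hl ih b
    rw [h.treeSum_of_lt hs hl, h.treeSum_of_lt hs hl]
    exact Finset.sum_congr rfl fun i hi => ih i (mem_range.1 hi) _

lemma le_treeSum_one {s : ℝ} (hs : 0 < s) (a l : ℝ) : l / s ≤ treeSum p r s 1 a l := by
  refine h.interval_induction hs (P := fun a l => l / s ≤ treeSum p r s 1 a l) ?_ ?_ a l
  · intro a l hl
    rw [treeSum_of_le hl]
    exact (div_le_one hs).2 hl
  · intro a l hl ih
    rw [h.treeSum_of_lt hs hl]
    calc l / s = ∑ i ∈ range p, (r (i + 1) - r i) * l / s := by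
          rw [← Finset.sum_div, ← Finset.sum_mul, h.sum_ratio, one_mul]
      _ ≤ _ := Finset.sum_le_sum fun i hi => ih i (mem_range.1 hi)

lemma treeSum_one_le {s b : ℝ} (hs : 0 < s) (hb : 0 < b) (hbr : ∀ i < p, b ≤ r (i + 1) - r i)
    (a l : ℝ) : treeSum p r s 1 a l ≤ max 1 (l / (b * s)) := by
  refine h.interval_induction hs
    (P := fun a l => treeSum p r s 1 a l ≤ max 1 (l / (b * s))) ?_ ?_ a l
  · intro a l hl
    rw [treeSum_of_le hl]
    exact le_max_left _ _
  · intro a l hl ih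
    rw [h.treeSum_of_lt hs hl]
    refine le_trans ?_ (le_max_right _ _)
    calc _ ≤ ∑ i ∈ range p, (r (i + 1) - r i) * l / (b * s) := by
          refine Finset.sum_le_sum fun i hi => (ih i (mem_range.1 hi)).trans (max_le ?_ le_rfl)
          rw [one_le_div (by positivity)]
          exact mul_le_mul (hbr i (mem_range.1 hi)) hl.le hs.le (h.ratio_pos (mem_range.1 hi)).le
      _ = l / (b * s) := by
          rw [← Finset.sum_div, ← Finset.sum_mul, h.sum_ratio, one_mul]

lemma abs_treeSum_sub_le {s : ℝ} (hs : 0 < s) {f : ℝ → ℝ} {u v c ε : ℝ}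
    (hf : ∀ x ∈ Set.Icc u v, |f x - c| ≤ ε) {a l : ℝ} (hl : 0 < l) (ha : u ≤ a)
    (hal : a + l ≤ v) :
    |treeSum p r s f a l - c * treeSum p r s 1 a l| ≤ ε * treeSum p r s 1 a l := by
  refine h.interval_induction hs (P := fun a l => 0 < l → u ≤ a → a + l ≤ v →
    |treeSum p r s f a l - c * treeSum p r s 1 a l| ≤ ε * treeSum p r s 1 a l)
    ?_ ?_ a l hl ha hal
  · intro a l hls hl ha hal
    simpa [treeSum_of_le hls] using hf a ⟨ha, by linarith⟩
  · intro a l hls ih hl ha hal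
    rw [h.treeSum_of_lt hs hls, h.treeSum_of_lt hs hls, Finset.mul_sum, Finset.mul_sum,
      ← Finset.sum_sub_distrib]
    refine (Finset.abs_sum_le_sum_abs _ _).trans (Finset.sum_le_sum fun i hi => ?_)
    have hi := mem_range.1 hi
    refine ih i hi (mul_pos (h.ratio_pos hi) hl) ?_ ?_
    · nlinarith [h.nonneg hi.le]
    · nlinarith [h.le_one (j := i + 1) hi]

/-- Bounded solutions of the mean value equation `φ l = ∑ αᵢ φ (αᵢ l)` are invariant under
multiplication by each `αᵢ`. -/
lemma eq_of_mean_value {φ : ℝ → ℝ} {C : ℝ} (h0 : ∀ l, 0 < l → 0 ≤ φ l)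
    (hC : ∀ l, 0 < l → φ l ≤ C)
    (hφ : ∀ l, 0 < l → φ l = ∑ i ∈ range p, (r (i + 1) - r i) * φ ((r (i + 1) - r i) * l))
    {i : ℕ} (hi : i < p) {l : ℝ} (hl : 0 < l) : φ ((r (i + 1) - r i) * l) = φ l := by
  have hle : ∀ i < p, ∀ l, 0 < l → φ ((r (i + 1) - r i) * l) ≤ φ l := by
    intro i hi
    by_contra! hcon
    obtain ⟨l₀, hl₀, hlt⟩ := hcon
    set q := r (i + 1) - r i with hq
    have hq0 : 0 < q := h.ratio_pos hi
    set g : ℝ → ℝ := fun l => φ (q * l) - φ l with hg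
    have hgm : ∀ l, 0 < l → g l = ∑ j ∈ range p, (r (j + 1) - r j) * g ((r (j + 1) - r j) * l) := by
      intro l hl
      simp only [hg]
      rw [hφ l hl, hφ (q * l) (mul_pos hq0 hl), ← Finset.sum_sub_distrib]
      refine Finset.sum_congr rfl fun j _ => ?_
      rw [mul_left_comm q]; ring
    set S : Set ℝ := g '' Set.Ioi 0 with hS
    have hbdd : BddAbove S := by
      refine ⟨C, ?_⟩
      rintro _ ⟨l, hl, rfl⟩
      have := h0 l hl
      have := hC (q * l) (mul_pos hq0 hl)
      simp only [hg]; linarith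
    set σ := sSup S
    have hgσ : ∀ l, 0 < l → g l ≤ σ := fun l hl => le_csSup hbdd ⟨l, hl, rfl⟩
    have hσ : 0 < σ := (sub_pos.2 hlt).trans_le (hgσ l₀ hl₀)
    have hstep : ∀ ε l, 0 < l → σ - ε ≤ g l → σ - ε / q ≤ g (q * l) := by
      intro ε l hl hε
      have h1 : ∑ j ∈ range p, (r (j + 1) - r j) * (σ - g ((r (j + 1) - r j) * l)) = σ - g l := by
        simp only [mul_sub (_ - _)]
        rw [Finset.sum_sub_distrib, ← Finset.sum_mul, h.sum_ratio, one_mul, ← hgm l hl]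
      have h2 : q * (σ - g (q * l)) ≤ σ - g l := by
        rw [← h1]
        refine Finset.single_le_sum
          (f := fun j => (r (j + 1) - r j) * (σ - g ((r (j + 1) - r j) * l)))
          (fun j hj => ?_) (mem_range.2 hi)
        have hj := h.ratio_pos (mem_range.1 hj)
        exact mul_nonneg hj.le (sub_nonneg.2 (hgσ _ (mul_pos hj hl)))
      have h3 : σ - g (q * l) ≤ ε / q := by
        rw [le_div_iff₀ hq0]; linarith
      linarith
    obtain ⟨k, hk⟩ := exists_nat_gt (C / (σ / 2))
    rw [div_lt_iff₀ (by positivity)] at hk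
    obtain ⟨_, ⟨l, hl, rfl⟩, hgl⟩ := exists_lt_of_lt_csSup (s := S)
      ⟨_, l₀, hl₀, rfl⟩ (sub_lt_self σ (show 0 < q ^ k * (σ / 2) by positivity))
    have hl : 0 < l := hl
    have hiter : ∀ j : ℕ, σ - q ^ k * (σ / 2) / q ^ j ≤ g (q ^ j * l) := by
      intro j
      induction j with
      | zero => simpa using hgl.le
      | succ j ih =>
        have := hstep _ _ (by positivity) ih
        rw [pow_succ, ← div_div, mul_comm (q ^ j) q, mul_assoc]
        exact this
    have hhalf : ∀ j ∈ range k, σ / 2 ≤ g (q ^ j * l) := by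
      intro j hj
      refine le_trans ?_ (hiter j)
      have hpow : q ^ k ≤ q ^ j :=
        pow_le_pow_of_le_one hq0.le (h.ratio_lt_one hi).le (mem_range.1 hj).le
      have : q ^ k * (σ / 2) / q ^ j ≤ σ / 2 := by
        rw [div_le_iff₀ (by positivity), mul_comm]; gcongr
      linarith
    have hsum := Finset.sum_le_sum hhalf
    have htel : ∑ j ∈ range k, g (q ^ j * l) = φ (q ^ k * l) - φ l := by
      have := Finset.sum_range_sub (fun j => φ (q ^ j * l)) k
      simp only [pow_zero, one_mul] at this
      rw [← this]
      refine Finset.sum_congr rfl fun j _ => ?_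
      simp only [hg, pow_succ']
      rw [mul_assoc]
    rw [htel, Finset.sum_const, card_range, nsmul_eq_mul] at hsum
    have := h0 l hl
    have := hC (q ^ k * l) (by positivity)
    linarith
  have hz : ∑ i ∈ range p, (r (i + 1) - r i) * (φ l - φ ((r (i + 1) - r i) * l)) = 0 := by
    simp only [mul_sub (_ - _)]
    rw [Finset.sum_sub_distrib, ← Finset.sum_mul, h.sum_ratio, one_mul, ← hφ l hl, sub_self]
  have := (Finset.sum_eq_zero_iff_of_nonneg (fun j hj => mul_nonneg
    (h.ratio_pos (mem_range.1 hj)).le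
    (sub_nonneg.2 (hle j (mem_range.1 hj) l hl)))).1 hz i (mem_range.2 hi)
  rcases mul_eq_zero.1 this with h1 | h1
  · exact absurd h1 (h.ratio_pos hi).ne'
  · linarith

end IsSubdivision

lemma exists_tendsto_of_eventually_mem_Icc {α : Type*} (U : Ultrafilter α) {φ : α → ℝ} {a b : ℝ}
    (hφ : ∀ᶠ s in (U : Filter α), φ s ∈ Set.Icc a b) :
    ∃ x ∈ Set.Icc a b, Tendsto φ U (𝓝 x) :=
  (isCompact_Icc (a := a) (b := b)).ultrafilter_le_nhds' (U.map φ) hφ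

namespace IsSubdivision

variable {p : ℕ} {r : ℕ → ℝ} (h : IsSubdivision p r)

include h

lemma integral_eq_sum {f : ℝ → ℝ} (hf : ContinuousOn f (Set.Icc 0 1)) {a l : ℝ} (hl : 0 < l)
    (ha : 0 ≤ a) (hal : a + l ≤ 1) :
    ∫ x in a..(a + l), f x =
      ∑ i ∈ range p, ∫ x in (a + r i * l)..(a + r i * l + (r (i + 1) - r i) * l), f x := by
  have := intervalIntegral.sum_integral_adjacent_intervals (f := f) (μ := MeasureTheory.volume)
    (a := fun i => a + r i * l) (n := p) (fun i hi => by
      have h1 := h.nonneg hi.le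
      have h2 := h.le_one (j := i + 1) hi
      have h3 := h.mono i (i + 1) (Nat.lt_succ_self i) hi
      refine (hf.mono ?_).intervalIntegrable
      rw [Set.uIcc_of_le (by nlinarith)]
      exact Set.Icc_subset_Icc (by positivity) (by nlinarith))
  rw [h.zero, h.one, zero_mul, add_zero, one_mul] at this
  rw [← this]
  refine Finset.sum_congr rfl fun i _ => ?_
  congr 1; ring

/-- As the threshold `s` tends to `0`, the left endpoints of the intervals obtained by subdividing
all intervals longer than `s` become uniformly distributed. -/
theorem tendsto_treeSum_div {f : ℝ → ℝ} (hf : ContinuousOn f (Set.Icc 0 1)) :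
    Tendsto (fun s => treeSum p r s f 0 1 / treeSum p r s 1 0 1) (𝓝[>] 0)
      (𝓝 (∫ x in (0:ℝ)..1, f x)) := by
  rw [tendsto_iff_ultrafilter]
  intro U hU
  obtain ⟨b, hb, hbr⟩ := h.exists_le_ratio
  have hb1 : b ≤ 1 := by
    have h2 := h.two_le
    exact (hbr 0 (by omega)).trans (h.ratio_lt_one (by omega)).le
  have hpos : ∀ᶠ s in (U : Filter ℝ), 0 < s := hU self_mem_nhdsWithin
  have hlt : ∀ l : ℝ, 0 < l → ∀ᶠ s in (U : Filter ℝ), s < l := fun l hl =>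
    hU (mem_nhdsWithin_of_mem_nhds (Iio_mem_nhds hl))
  have hN : ∀ s : ℝ, 0 < s → 0 < treeSum p r s 1 0 1 := fun s hs =>
    (one_div_pos.2 hs).trans_le (h.le_treeSum_one hs 0 1)
  have hνs : ∀ l : ℝ, 0 < l → ∀ᶠ s in (U : Filter ℝ),
      treeSum p r s 1 0 l / treeSum p r s 1 0 1 ∈ Set.Icc 0 (l / b) := by
    intro l hl
    filter_upwards [hpos, hlt l hl] with s hs hsl
    have h1 := h.le_treeSum_one hs 0 1
    have h2 := h.le_treeSum_one hs 0 l
    have h3 := h.treeSum_one_le hs hb hbr 0 l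
    refine ⟨div_nonneg (le_trans (by positivity) h2) (hN s hs).le, ?_⟩
    rw [div_le_iff₀ (hN s hs)]
    have h4 : 1 ≤ l / (b * s) := by
      rw [one_le_div (by positivity)]; nlinarith
    rw [max_eq_right h4] at h3
    calc _ ≤ l / (b * s) := h3
      _ = l / b * (1 / s) := by field_simp
      _ ≤ _ := by gcongr
  choose! ν hνmem hν using fun l hl => exists_tendsto_of_eventually_mem_Icc U (hνs l hl)
  have hν_sum : ∀ l, 0 < l → ν l = ∑ i ∈ range p, ν ((r (i + 1) - r i) * l) := by
    intro l hl
    refine tendsto_nhds_unique (hν l hl) (Tendsto.congr' ?_ (tendsto_finsetSum _ fun i hi =>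
      hν _ (mul_pos (h.ratio_pos (mem_range.1 hi)) hl)))
    filter_upwards [hpos, hlt l hl] with s hs hsl
    rw [h.treeSum_of_lt hs hsl, Finset.sum_div]
    refine Finset.sum_congr rfl fun i _ => ?_
    rw [h.treeSum_one_congr hs 0]
  have hν_one : ν 1 = 1 := by
    refine tendsto_nhds_unique (hν 1 one_pos) (Tendsto.congr' ?_ tendsto_const_nhds)
    filter_upwards [hpos] with s hs
    rw [div_self (hN s hs).ne']
  have hκ : ∀ i < p, ∀ l, 0 < l →
      ν ((r (i + 1) - r i) * l) / ((r (i + 1) - r i) * l) = ν l / l := by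
    intro i hi l hl
    refine h.eq_of_mean_value (φ := fun l => ν l / l) (C := 1 / b)
      (fun l hl => div_nonneg (hνmem l hl).1 hl.le) (fun l hl => ?_) (fun l hl => ?_) hi hl
    · rw [div_le_iff₀ hl]
      exact (hνmem l hl).2.trans_eq (by ring)
    · rw [hν_sum l hl, Finset.sum_div]
      refine Finset.sum_congr rfl fun i hi => ?_
      have := h.ratio_pos (mem_range.1 hi)
      field_simp
  obtain ⟨M, hM⟩ := isCompact_Icc.exists_bound_of_continuousOn hf
  have hM0 : 0 ≤ M := (norm_nonneg _).trans (hM 0 ⟨le_rfl, zero_le_one⟩)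
  have happrox : ∀ {u v c ε : ℝ}, (∀ x ∈ Set.Icc u v, |f x - c| ≤ ε) → ∀ {a l : ℝ}, 0 < l →
      u ≤ a → a + l ≤ v → ∀ s, 0 < s →
      |treeSum p r s f a l / treeSum p r s 1 0 1 -
        c * (treeSum p r s 1 0 l / treeSum p r s 1 0 1)| ≤
        ε * (treeSum p r s 1 0 l / treeSum p r s 1 0 1) := by
    intro u v c ε hfc a l hl ha hal s hs
    have h1 := h.abs_treeSum_sub_le hs hfc hl ha hal
    rw [h.treeSum_one_congr hs a 0] at h1
    rw [← mul_div_assoc, ← mul_div_assoc, ← sub_div, abs_div, abs_of_pos (hN s hs)]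
    exact div_le_div_of_nonneg_right h1 (hN s hs).le
  have hΦs : ∀ a l : ℝ, 0 < l → 0 ≤ a → a + l ≤ 1 → ∃ x ∈ Set.Icc (-(M * (l / b))) (M * (l / b)),
      Tendsto (fun s => treeSum p r s f a l / treeSum p r s 1 0 1) U (𝓝 x) := by
    intro a l hl ha hal
    refine exists_tendsto_of_eventually_mem_Icc U ?_
    filter_upwards [hpos, hνs l hl] with s hs hνs
    have := happrox (u := 0) (v := 1) (c := 0) (ε := M) (by simpa using hM) hl ha hal s hs
    rw [zero_mul, sub_zero] at this
    exact abs_le.1 (this.trans (mul_le_mul_of_nonneg_left hνs.2 hM0))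
  choose! Φ _ hΦ using hΦs
  have hchild : ∀ i < p, ∀ a l : ℝ, 0 < l → 0 ≤ a → a + l ≤ 1 →
      0 < (r (i + 1) - r i) * l ∧ 0 ≤ a + r i * l ∧
        a + r i * l + (r (i + 1) - r i) * l ≤ 1 := by
    intro i hi a l hl ha hal
    have h1 := h.nonneg hi.le
    have h2 := h.le_one (j := i + 1) hi
    exact ⟨mul_pos (h.ratio_pos hi) hl, by positivity, by nlinarith⟩
  have hΦ_sum : ∀ a l, 0 < l → 0 ≤ a → a + l ≤ 1 →
      Φ a l = ∑ i ∈ range p, Φ (a + r i * l) ((r (i + 1) - r i) * l) := by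
    intro a l hl ha hal
    refine tendsto_nhds_unique (hΦ a l hl ha hal) (Tendsto.congr' ?_
      (tendsto_finsetSum _ fun i hi =>
        have hc := hchild i (mem_range.1 hi) a l hl ha hal
        hΦ _ _ hc.1 hc.2.1 hc.2.2))
    filter_upwards [hpos, hlt l hl] with s hs hsl
    rw [h.treeSum_of_lt hs hsl f, Finset.sum_div]
  have hD : ∀ ε : ℝ, 0 < ε → ∀ a l : ℝ, 0 < l → 0 ≤ a → a + l ≤ 1 →
      |Φ a l - ν l / l * ∫ x in a..(a + l), f x| ≤ 2 * ε * ν l := by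
    intro ε hε
    obtain ⟨δ, hδ, hfδ⟩ := Metric.uniformContinuousOn_iff_le.1
      (isCompact_Icc.uniformContinuousOn_of_continuous hf) ε hε
    intro a l
    refine h.interval_induction hδ (P := fun a l => 0 < l → 0 ≤ a → a + l ≤ 1 →
      |Φ a l - ν l / l * ∫ x in a..(a + l), f x| ≤ 2 * ε * ν l) ?_ ?_ a l
    · intro a l hlδ hl ha hal
      have hosc : ∀ x ∈ Set.Icc a (a + l), |f x - f a| ≤ ε := by
        intro x hx
        refine hfδ x ⟨ha.trans hx.1, hx.2.trans hal⟩ a ⟨ha, by linarith⟩ ?_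
        rw [Real.dist_eq, abs_le]
        constructor <;> linarith [hx.1, hx.2]
      have h1 : |Φ a l - f a * ν l| ≤ ε * ν l := by
        refine le_of_tendsto_of_tendsto
          ((hΦ a l hl ha hal).sub ((hν l hl).const_mul (f a))).abs ((hν l hl).const_mul ε) ?_
        filter_upwards [hpos] with s hs
        exact happrox hosc hl le_rfl le_rfl s hs
      have hint : IntervalIntegrable f MeasureTheory.volume a (a + l) := by
        refine (hf.mono ?_).intervalIntegrable
        rw [Set.uIcc_of_le (by linarith)]
        exact Set.Icc_subset_Icc ha hal
      have h2 : |(∫ x in a..(a + l), f x) - f a * l| ≤ ε * l := by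
        have h3 := intervalIntegral.norm_integral_le_of_norm_le_const (a := a) (b := a + l)
          (f := fun x => f x - f a) (C := ε) (fun x hx => by
            rw [Set.uIoc_of_le (by linarith)] at hx
            exact hosc x ⟨hx.1.le, hx.2⟩)
        rw [intervalIntegral.integral_sub hint intervalIntegrable_const,
          intervalIntegral.integral_const, add_sub_cancel_left, abs_of_pos hl, smul_eq_mul,
          mul_comm l, Real.norm_eq_abs] at h3
        exact h3
      have hκ0 : 0 ≤ ν l / l := div_nonneg (hνmem l hl).1 hl.le
      have h4 : |ν l / l * ((∫ x in a..(a + l), f x) - f a * l)| ≤ ε * ν l := by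
        rw [abs_mul, abs_of_nonneg hκ0]
        calc _ ≤ ν l / l * (ε * l) := by gcongr
          _ = ε * ν l := by field_simp
      have h5 : Φ a l - ν l / l * ∫ x in a..(a + l), f x =
          (Φ a l - f a * ν l) - ν l / l * ((∫ x in a..(a + l), f x) - f a * l) := by
        field_simp; ring
      rw [h5]
      refine (abs_sub _ _).trans ?_
      linarith
    · intro a l _ ih hl ha hal
      rw [hΦ_sum a l hl ha hal, h.integral_eq_sum hf hl ha hal, hν_sum l hl, Finset.mul_sum,
        Finset.mul_sum, ← Finset.sum_sub_distrib, ← hν_sum l hl]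
      refine (Finset.abs_sum_le_sum_abs _ _).trans (Finset.sum_le_sum fun i hi => ?_)
      obtain ⟨h1, h2, h3⟩ := hchild i (mem_range.1 hi) a l hl ha hal
      rw [← hκ i (mem_range.1 hi) l hl]
      exact ih i (mem_range.1 hi) h1 h2 h3
  have hfinal : Φ 0 1 = ∫ x in (0:ℝ)..1, f x := by
    refine eq_of_forall_dist_le fun ε hε => ?_
    have := hD (ε / 2) (by positivity) 0 1 one_pos le_rfl (by norm_num)
    rw [hν_one, zero_add, div_one, one_mul] at this
    rw [Real.dist_eq]
    linarith
  rw [← hfinal]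
  exact hΦ 0 1 one_pos le_rfl (by norm_num)

end IsSubdivision

/-- `P` represents a partition of `[0,1)`. -/
structure IsPart (P : Finset ℝ) : Prop where
  zero_mem : (0 : ℝ) ∈ P
  mem_Ico : ∀ y ∈ P, y ∈ Set.Ico (0 : ℝ) 1

section nextPt

variable {P : Finset ℝ} {y z : ℝ}

lemma finite_nextPt_set (P : Finset ℝ) (y : ℝ) :
    ({z : ℝ | z ∈ P ∧ y < z} ∪ {1}).Finite :=
  (P.finite_toSet.subset fun _ hz => hz.1).union (Set.finite_singleton 1)

lemma nextPt_mem (P : Finset ℝ) (y : ℝ) : (nextPt P y ∈ P ∧ y < nextPt P y) ∨ nextPt P y = 1 :=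
  Set.Nonempty.csInf_mem (s := {z : ℝ | z ∈ P ∧ y < z} ∪ {1}) ⟨1, Or.inr rfl⟩ (finite_nextPt_set P y)

lemma nextPt_le (hz : z ∈ P) (hyz : y < z) : nextPt P y ≤ z :=
  csInf_le (finite_nextPt_set P y).bddBelow (Or.inl ⟨hz, hyz⟩)

lemma nextPt_le_one (P : Finset ℝ) (y : ℝ) : nextPt P y ≤ 1 :=
  csInf_le (finite_nextPt_set P y).bddBelow (Or.inr rfl)

lemma lt_nextPt (hy : y < 1) : y < nextPt P y := by
  rcases nextPt_mem P y with h | h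
  · exact h.2
  · exact h ▸ hy

lemma nextPt_eq (hyz : y < z) (hz : z ∈ P ∨ z = 1) (hz1 : z ≤ 1)
    (hmin : ∀ w ∈ P, y < w → z ≤ w) : nextPt P y = z := by
  apply le_antisymm
  · rcases hz with hz | rfl
    · exact nextPt_le hz hyz
    · exact nextPt_le_one P y
  · rcases nextPt_mem P y with h | h
    · exact hmin _ h.1 h.2
    · exact h ▸ hz1

lemma length_le_maxLen (hy : y ∈ P) : nextPt P y - y ≤ maxLen P :=
  le_csSup (P.finite_toSet.image _).bddAbove ⟨y, hy, rfl⟩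

lemma exists_length_eq_maxLen (hP : P.Nonempty) : ∃ y ∈ P, nextPt P y - y = maxLen P :=
  Set.Nonempty.csSup_mem (s := (fun y => nextPt P y - y) '' (P : Set ℝ))
    ⟨_, hP.choose, hP.choose_spec, rfl⟩ (P.finite_toSet.image _)

lemma nextPt_singleton_zero : nextPt {0} 0 = 1 :=
  nextPt_eq zero_lt_one (Or.inr rfl) le_rfl (by simp)

lemma IsPart.maxLen_pos (hP : IsPart P) : 0 < maxLen P := by
  have := length_le_maxLen hP.zero_mem
  have := lt_nextPt (P := P) zero_lt_one
  linarith

end nextPt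

/-- The points of the `ρ`-refinement of `P` that lie in the interval of `P` starting at `y`. -/
noncomputable def refinePts (p : ℕ) (r : ℕ → ℝ) (P : Finset ℝ) (y : ℝ) : Finset ℝ :=
  if nextPt P y - y = maxLen P then (range p).image fun j => y + r j * (nextPt P y - y) else {y}

namespace IsSubdivision

variable {p : ℕ} {r : ℕ → ℝ} (h : IsSubdivision p r) {P : Finset ℝ} (hP : IsPart P)

include h

lemma rhoRefine_eq_biUnion (P : Finset ℝ) :
    rhoRefine p r P = P.biUnion (refinePts p r P) := by
  have h2 := h.two_le
  ext x
  simp only [rhoRefine, refinePts, mem_union, mem_biUnion, mem_filter, mem_image, mem_Ico]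
  constructor
  · rintro (hx | ⟨y, ⟨hy, hm⟩, j, hj, rfl⟩)
    · refine ⟨x, hx, ?_⟩
      split_ifs
      · exact mem_image.2 ⟨0, by simp; omega, by simp [h.zero]⟩
      · simp
    · refine ⟨y, hy, ?_⟩
      rw [if_pos hm]
      exact mem_image.2 ⟨j, mem_range.2 hj.2, rfl⟩
  · rintro ⟨y, hy, hx⟩
    split_ifs at hx with hm
    · obtain ⟨j, hj, rfl⟩ := mem_image.1 hx
      rcases Nat.eq_zero_or_pos j with rfl | hj0
      · left; simpa [h.zero] using hy
      · exact Or.inr ⟨y, ⟨hy, hm⟩, j, ⟨hj0, mem_range.1 hj⟩, rfl⟩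
    · rw [mem_singleton.1 hx]; exact Or.inl hy

include hP

lemma mem_Ico_of_mem_refinePts {x y : ℝ} (hy : y ∈ P) (hx : x ∈ refinePts p r P y) :
    x ∈ Set.Ico y (nextPt P y) := by
  have hlt := lt_nextPt (P := P) (hP.mem_Ico y hy).2
  rw [refinePts] at hx
  split_ifs at hx with hm
  · obtain ⟨j, hj, rfl⟩ := mem_image.1 hx
    have hj := mem_range.1 hj
    have h1 := h.nonneg hj.le
    have h2 := h.lt_one hj
    constructor <;> nlinarith
  · rw [mem_singleton.1 hx]
    exact ⟨le_rfl, hlt⟩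

lemma isPart_rhoRefine : IsPart (rhoRefine p r P) := by
  refine ⟨mem_union_left _ hP.zero_mem, fun x hx => ?_⟩
  rw [h.rhoRefine_eq_biUnion] at hx
  obtain ⟨y, hy, hx⟩ := mem_biUnion.1 hx
  have h1 := h.mem_Ico_of_mem_refinePts hP hy hx
  exact ⟨(hP.mem_Ico y hy).1.trans h1.1, h1.2.trans_le (nextPt_le_one P y)⟩

lemma pairwiseDisjoint_refinePts :
    (P : Set ℝ).PairwiseDisjoint (refinePts p r P) := by
  have key : ∀ y ∈ P, ∀ z ∈ P, y < z → Disjoint (refinePts p r P y) (refinePts p r P z) := by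
    intro y hy z hz hyz
    rw [Finset.disjoint_left]
    intro x hxy hxz
    have h1 := (h.mem_Ico_of_mem_refinePts hP hy hxy).2
    have h2 := (h.mem_Ico_of_mem_refinePts hP hz hxz).1
    have h3 := nextPt_le hz hyz
    linarith
  intro y hy z hz hyz
  rcases lt_or_gt_of_ne hyz with hlt | hlt
  · exact key y hy z hz hlt
  · exact (key z hz y hy hlt).symm

lemma nextPt_le_of_mem_rhoRefine {y w x : ℝ} (hy : y ∈ P) (hx : x ∈ Set.Ico y (nextPt P y))
    (hw : w ∈ rhoRefine p r P) (hxw : x < w) : w ∈ refinePts p r P y ∨ nextPt P y ≤ w := by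
  rw [h.rhoRefine_eq_biUnion] at hw
  obtain ⟨z, hz, hw⟩ := mem_biUnion.1 hw
  have h1 := h.mem_Ico_of_mem_refinePts hP hz hw
  rcases lt_trichotomy y z with hyz | rfl | hyz
  · exact Or.inr ((nextPt_le hz hyz).trans h1.1)
  · exact Or.inl hw
  · have := nextPt_le hy hyz
    linarith [h1.2, hx.1]

lemma nextPt_rhoRefine_of_ne {y : ℝ} (hy : y ∈ P) (hm : nextPt P y - y ≠ maxLen P) :
    nextPt (rhoRefine p r P) y = nextPt P y := by
  have hlt := lt_nextPt (P := P) (hP.mem_Ico y hy).2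
  refine nextPt_eq hlt ((nextPt_mem P y).imp_left fun h1 => mem_union_left _ h1.1)
    (nextPt_le_one P y) fun w hw hyw => ?_
  rcases h.nextPt_le_of_mem_rhoRefine hP hy ⟨le_rfl, hlt⟩ hw hyw with hw | hw
  · rw [refinePts, if_neg hm, mem_singleton] at hw
    exact absurd hw hyw.ne'
  · exact hw

lemma nextPt_rhoRefine_of_eq {y : ℝ} (hy : y ∈ P) (hm : nextPt P y - y = maxLen P) {j : ℕ}
    (hj : j < p) : nextPt (rhoRefine p r P) (y + r j * (nextPt P y - y)) =
      y + r (j + 1) * (nextPt P y - y) := by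
  have hlt := lt_nextPt (P := P) (hP.mem_Ico y hy).2
  have hL : 0 < nextPt P y - y := sub_pos.2 hlt
  have hA : refinePts p r P y = (range p).image fun j => y + r j * (nextPt P y - y) := if_pos hm
  have hmem : ∀ k < p, y + r k * (nextPt P y - y) ∈ refinePts p r P y := fun k hk =>
    hA ▸ mem_image.2 ⟨k, mem_range.2 hk, rfl⟩
  have hle1 := h.le_one (j := j + 1) hj
  have hone := nextPt_le_one P y
  refine nextPt_eq ?_ ?_ ?_ fun w hw hyw => ?_
  · have := h.mono j (j + 1) (Nat.lt_succ_self j) hj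
    gcongr
  · rcases (show j + 1 ≤ p from hj).lt_or_eq with hj1 | hj1
    · left
      rw [h.rhoRefine_eq_biUnion]
      exact mem_biUnion.2 ⟨y, hy, hmem _ hj1⟩
    · rw [hj1, h.one, one_mul, add_sub_cancel]
      exact (nextPt_mem P y).imp_left fun h1 => mem_union_left _ h1.1
  · nlinarith
  · rcases h.nextPt_le_of_mem_rhoRefine hP hy
      (h.mem_Ico_of_mem_refinePts hP hy (hmem j hj)) hw hyw with hw | hw
    · rw [hA] at hw
      obtain ⟨k, hk, rfl⟩ := mem_image.1 hw
      have hjk : j < k := by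
        by_contra! hkj
        have := h.le_of_le hkj hj.le
        nlinarith
      have := h.le_of_le hjk (mem_range.1 hk).le
      gcongr
    · nlinarith

lemma sum_rhoRefine (g : ℝ → ℝ → ℝ) :
    ∑ x ∈ rhoRefine p r P, g x (nextPt (rhoRefine p r P) x - x) =
      ∑ y ∈ P, if nextPt P y - y = maxLen P then
        ∑ i ∈ range p, g (y + r i * (nextPt P y - y)) ((r (i + 1) - r i) * (nextPt P y - y))
      else g y (nextPt P y - y) := by
  conv_lhs => enter [1]; rw [h.rhoRefine_eq_biUnion]
  rw [Finset.sum_biUnion (h.pairwiseDisjoint_refinePts hP)]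
  refine Finset.sum_congr rfl fun y hy => ?_
  have hlt := lt_nextPt (P := P) (hP.mem_Ico y hy).2
  rw [refinePts]
  split_ifs with hm
  · rw [Finset.sum_image]
    · refine Finset.sum_congr rfl fun i hi => ?_
      rw [h.nextPt_rhoRefine_of_eq hP hy hm (mem_range.1 hi)]
      congr 1; ring
    · intro i hi j hj hij
      have hL : nextPt P y - y ≠ 0 := (sub_pos.2 hlt).ne'
      have hij : r i = r j := by simpa [hL] using hij
      have hi := mem_range.1 hi
      have hj := mem_range.1 hj
      rcases lt_trichotomy i j with hlt | heq | hlt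
      · exact absurd hij (h.mono i j hlt hj.le).ne
      · exact heq
      · exact absurd hij (h.mono j i hlt hi.le).ne'
  · rw [Finset.sum_singleton, h.nextPt_rhoRefine_of_ne hP hy hm]

lemma maxLen_rhoRefine_lt : maxLen (rhoRefine p r P) < maxLen P := by
  obtain ⟨x, hx, hxm⟩ := exists_length_eq_maxLen (P := rhoRefine p r P)
    ⟨0, (h.isPart_rhoRefine hP).zero_mem⟩
  rw [← hxm]
  have hx' := hx
  rw [h.rhoRefine_eq_biUnion] at hx'
  obtain ⟨y, hy, hxy⟩ := mem_biUnion.1 hx'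
  have hlt := lt_nextPt (P := P) (hP.mem_Ico y hy).2
  by_cases hm : nextPt P y - y = maxLen P
  · rw [refinePts, if_pos hm] at hxy
    obtain ⟨i, hi, rfl⟩ := mem_image.1 hxy
    have hi := mem_range.1 hi
    rw [h.nextPt_rhoRefine_of_eq hP hy hm hi, ← hm]
    nlinarith [h.ratio_lt_one hi]
  · rw [refinePts, if_neg hm, mem_singleton] at hxy
    rw [hxy, h.nextPt_rhoRefine_of_ne hP hy hm]
    exact lt_of_le_of_ne (length_le_maxLen hy) hm

lemma card_lt_card_rhoRefine : P.card < (rhoRefine p r P).card := by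
  refine Finset.card_lt_card (Finset.ssubset_iff_subset_ne.2 ⟨Finset.subset_union_left, ?_⟩)
  intro heq
  have := h.maxLen_rhoRefine_lt hP
  rw [← heq] at this
  exact lt_irrefl _ this

/-- Refining does not change sums of tree sums whose threshold is below the maximal length. -/
lemma sum_treeSum_rhoRefine {s : ℝ} (hs : 0 < s) (hsP : s < maxLen P) (f : ℝ → ℝ) :
    ∑ x ∈ rhoRefine p r P, treeSum p r s f x (nextPt (rhoRefine p r P) x - x) =
      ∑ y ∈ P, treeSum p r s f y (nextPt P y - y) := by
  rw [h.sum_rhoRefine hP]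
  refine Finset.sum_congr rfl fun y _ => ?_
  split_ifs with hm
  · rw [h.treeSum_of_lt hs (hm ▸ hsP)]
  · rfl

omit hP

lemma isPart_iterate (n : ℕ) : IsPart ((rhoRefine p r)^[n] {0}) := by
  induction n with
  | zero => exact ⟨by simp, by simp⟩
  | succ n ih =>
    rw [Function.iterate_succ_apply']
    exact h.isPart_rhoRefine ih

lemma sum_treeSum_iterate {s : ℝ} (hs : 0 < s) (f : ℝ → ℝ) (n : ℕ)
    (hsn : s ≤ maxLen ((rhoRefine p r)^[n] {0})) :
    ∑ y ∈ (rhoRefine p r)^[n] {0},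
      treeSum p r s f y (nextPt ((rhoRefine p r)^[n] {0}) y - y) = treeSum p r s f 0 1 := by
  induction n with
  | zero => simp [nextPt_singleton_zero]
  | succ n ih =>
    rw [Function.iterate_succ_apply'] at hsn ⊢
    have hlt := hsn.trans_lt (h.maxLen_rhoRefine_lt (h.isPart_iterate n))
    rw [h.sum_treeSum_rhoRefine (h.isPart_iterate n) hs hlt, ih hlt.le]

lemma sum_iterate_eq_treeSum (f : ℝ → ℝ) (n : ℕ) :
    ∑ y ∈ (rhoRefine p r)^[n] {0}, f y =
      treeSum p r (maxLen ((rhoRefine p r)^[n] {0})) f 0 1 := by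
  rw [← h.sum_treeSum_iterate ((h.isPart_iterate n).maxLen_pos) f n le_rfl]
  exact Finset.sum_congr rfl fun y hy => (treeSum_of_le (length_le_maxLen hy) f y).symm

lemma card_iterate_eq_treeSum (n : ℕ) :
    (((rhoRefine p r)^[n] {0}).card : ℝ) =
      treeSum p r (maxLen ((rhoRefine p r)^[n] {0})) 1 0 1 := by
  rw [← h.sum_iterate_eq_treeSum]
  simp

lemma lt_card_iterate (n : ℕ) : n < ((rhoRefine p r)^[n] {0}).card := by
  induction n with
  | zero => simp
  | succ n ih =>
    rw [Function.iterate_succ_apply']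
    have := h.card_lt_card_rhoRefine (h.isPart_iterate n)
    omega

lemma tendsto_maxLen_iterate :
    Tendsto (fun n => maxLen ((rhoRefine p r)^[n] {0})) atTop (𝓝[>] 0) := by
  have hpos := fun n => (h.isPart_iterate n).maxLen_pos
  refine tendsto_nhdsWithin_iff.2 ⟨?_, Eventually.of_forall hpos⟩
  obtain ⟨b, hb, hbr⟩ := h.exists_le_ratio
  have hlim : Tendsto (fun n : ℕ => 1 / b / (n : ℝ)) atTop (𝓝 0) :=
    tendsto_const_div_atTop_nhds_zero_nat _
  refine squeeze_zero' (Eventually.of_forall fun n => (hpos n).le) ?_ hlim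
  filter_upwards [eventually_ge_atTop 1] with n hn
  have h1 := h.treeSum_one_le (hpos n) hb hbr 0 1
  rw [← h.card_iterate_eq_treeSum] at h1
  have h2 : (n : ℝ) < ((rhoRefine p r)^[n] {0}).card := by exact_mod_cast h.lt_card_iterate n
  have hn' : (1 : ℝ) ≤ n := by exact_mod_cast hn
  have hpos := hpos n
  have h3 : (n : ℝ) < 1 / (b * maxLen ((rhoRefine p r)^[n] {0})) := by
    rcases lt_max_iff.1 (h2.trans_le h1) with h4 | h4
    · linarith
    · exact h4
  rw [lt_div_iff₀ (by positivity)] at h3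
  rw [div_div, le_div_iff₀ (by positivity)]
  linarith

end IsSubdivision

/-- Let `ρ` be a nontrivial finite partition of `[0,1)`, given by points
`0 = r 0 < r 1 < ⋯ < r p = 1` with `p ≥ 2`, and let `ρⁿω` be the `n`-th successive
`ρ`-refinement of the trivial partition `ω = {0}` of `[0,1)`.  Then `(ρⁿω)` is uniformly
distributed: for every continuous `f : [0,1] → ℝ`,
`(1/|ρⁿω|) Σ_{y ∈ ρⁿω} f(y) → ∫₀¹ f(x) dx` as `n → ∞`. -/
theorem stmt_18 (p : ℕ) (hp : 2 ≤ p) (r : ℕ → ℝ)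
    (hr0 : r 0 = 0) (hrp : r p = 1)
    (hrmono : ∀ j k : ℕ, j < k → k ≤ p → r j < r k) :
    ∀ f : ℝ → ℝ, ContinuousOn f (Set.Icc 0 1) →
      Filter.Tendsto
        (fun n : ℕ => (1 / (((rhoRefine p r)^[n] {0}).card : ℝ)) *
          ∑ y ∈ (rhoRefine p r)^[n] {0}, f y)
        Filter.atTop (nhds (∫ x in (0:ℝ)..1, f x)) := by
  intro f hf
  have h : IsSubdivision p r := ⟨hp, hr0, hrp, hrmono⟩
  refine ((h.tendsto_treeSum_div hf).comp h.tendsto_maxLen_iterate).congr fun n => ?_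
  rw [Function.comp_apply, ← h.sum_iterate_eq_treeSum, ← h.card_iterate_eq_treeSum, one_div,
    div_eq_inv_mul]
end
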